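/- arXiv:1705.04587 — 2 statements merged into one kernel-verified Lean document; each statement's English description precedes it below -/
import Mathlib

section
/- In every normal-form feasible schedule of the constructed instance with makespan W, the job processed on machine 2 with start time 0 belongs to A ∪ B, the job processed on machine 3 with start time 0 belongs to A ∪ B, and the jobs processed on machines 2 and 3 that finish at time W belong to A ∪ B. -/
/-- Jobs of the instance constructed from a 3-Partition instance with parameter `z`. -/
inductive Job (z : ℕ) : Type
  | JA (i : Fin (z+1))
  | JB (i : Fin (z+1))
  | Ja (i : Fin z)
  | Jb (i : Fin z)
  | Jc (j : Fin (z+1))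
  | Jα (i : Fin z)
  | Jβ (i : Fin z)
  | Jγ (j : Fin z)
  | Jδ (j : Fin z)
  | Jl1
  | Jl2
  | Jpart (i : Fin (3*z))
  deriving DecidableEq, Fintype

/-- Processing times of the constructed jobs (`γ_j`, `δ_j` use index `j ∈ {1,…,z}`,
represented by `j.val + 1` for `j : Fin z`). -/
def pJob (z D : ℕ) (ι : Fin (3*z) → ℕ) : Job z → ℕ
  | .JA _ => D^2
  | .JB _ => D^3
  | .Ja _ => D^4 + D^6 + 3*z*D^7
  | .Jb _ => D^5 + D^6 + 3*z*D^7
  | .Jc j => (z + j.val)*D^7 + D^8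
  | .Jα _ => D^3 + D^5 + 4*z*D^7 + D^8
  | .Jβ _ => D^2 + D^4 + (4*z-1)*D^7 + D^8
  | .Jγ j => D^5 + (3*z - (j.val+1))*D^7 - D
  | .Jδ j => D^4 + (3*z - (j.val+1))*D^7
  | .Jl1 => D^3 + z*D^7 + D^8
  | .Jl2 => D^2 + 2*z*D^7 + D^8
  | .Jpart i => ι i

/-- Machine requirements of the constructed jobs. -/
def qJob (z : ℕ) : Job z → ℕ
  | .JA _ => 3
  | .JB _ => 3
  | .Ja _ => 2
  | .Jb _ => 2
  | .Jc _ => 2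
  | _ => 1

/-- Feasibility of a schedule `(σ, ρ)` on machines `{1,…,m}`: every job gets `q j`
machines among `{1,…,m}`, and jobs sharing a machine have disjoint half-open intervals. -/
def Feasible {J : Type} (m : ℕ) (p q : J → ℕ) (σ : J → ℕ) (ρ : J → Finset ℕ) : Prop :=
  (∀ j, ρ j ⊆ Finset.Icc 1 m) ∧ (∀ j, (ρ j).card = q j) ∧
  (∀ j j', j ≠ j' → (ρ j ∩ ρ j').Nonempty →
    σ j + p j ≤ σ j' ∨ σ j' + p j' ≤ σ j)

/-- Makespan of a schedule. -/
def makespan {J : Type} [Fintype J] (p σ : J → ℕ) : ℕ :=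
  Finset.univ.sup fun j => σ j + p j

/-- The target makespan `W`. -/
def Wval (z D : ℕ) : ℕ :=
  (z+1)*(D^2 + D^3 + D^8) + z*(D^4 + D^5 + D^6) + z*(7*z+1)*D^7

/-- The 3-Partition instance `ι` is a Yes-instance. -/
def IsYes (z D : ℕ) (ι : Fin (3*z) → ℕ) : Prop :=
  ∃ f : Fin (3*z) → Fin z,
    ∀ k : Fin z, ∑ i ∈ Finset.univ.filter (fun i => f i = k), ι i = D

/-- Jobs processed on machine 1 in a normal-form schedule: `A ∪ a ∪ α ∪ {λ₁}`. -/
def M1Jobs {z : ℕ} : Job z → Prop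
  | .JA _ => True
  | .Ja _ => True
  | .Jα _ => True
  | .Jl1 => True
  | _ => False

/-- Jobs processed on machine 4 in a normal-form schedule: `B ∪ b ∪ β ∪ {λ₂}`. -/
def M4Jobs {z : ℕ} : Job z → Prop
  | .JB _ => True
  | .Jb _ => True
  | .Jβ _ => True
  | .Jl2 => True
  | _ => False

/-- Jobs processed on both machines 2 and 3: `A ∪ B ∪ c`. -/
def BothM23 {z : ℕ} : Job z → Prop
  | .JA _ => True
  | .JB _ => True
  | .Jc _ => True
  | _ => False

/-- Jobs processed on exactly one of machines 2 and 3: `a ∪ b ∪ γ ∪ δ ∪ P`. -/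
def OneM23 {z : ℕ} : Job z → Prop
  | .Ja _ => True
  | .Jb _ => True
  | .Jγ _ => True
  | .Jδ _ => True
  | .Jpart _ => True
  | _ => False

/-- Normal form of a schedule of the constructed instance. -/
def NormalForm {z : ℕ} (ρ : Job z → Finset ℕ) : Prop :=
  (∀ j, 1 ∈ ρ j ↔ M1Jobs j) ∧
  (∀ j, 4 ∈ ρ j ↔ M4Jobs j) ∧
  (∀ j, BothM23 j → 2 ∈ ρ j ∧ 3 ∈ ρ j) ∧
  (∀ j, OneM23 j → ((2 ∈ ρ j) ↔ ¬ (3 ∈ ρ j)))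

/-- `cnt p σ S i` = number of jobs of `S` finishing no later than the start of `i`
(the quantity `#ᵢ S`). -/
def cnt {z : ℕ} (p σ : Job z → ℕ) (S : Finset (Job z)) (i : Job z) : ℕ :=
  (S.filter fun j => σ j + p j ≤ σ i).card

def sA (z : ℕ) : Finset (Job z) := Finset.univ.image Job.JA
def sB (z : ℕ) : Finset (Job z) := Finset.univ.image Job.JB
def sa (z : ℕ) : Finset (Job z) := Finset.univ.image Job.Ja
def sb (z : ℕ) : Finset (Job z) := Finset.univ.image Job.Jb
def sc (z : ℕ) : Finset (Job z) := Finset.univ.image Job.Jc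
def sα (z : ℕ) : Finset (Job z) := Finset.univ.image Job.Jα
def sβ (z : ℕ) : Finset (Job z) := Finset.univ.image Job.Jβ
def sγ (z : ℕ) : Finset (Job z) := Finset.univ.image Job.Jγ
def sδ (z : ℕ) : Finset (Job z) := Finset.univ.image Job.Jδ

def jobEquiv (z : ℕ) : Job z ≃ (Fin (z+1) ⊕ Fin (z+1) ⊕ Fin z ⊕ Fin z ⊕ Fin (z+1) ⊕ Fin z ⊕ Fin z ⊕
    Fin z ⊕ Fin z ⊕ Unit ⊕ Unit ⊕ Fin (3*z)) where
  toFun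
    | .JA i => .inl i
    | .JB i => .inr (.inl i)
    | .Ja i => .inr (.inr (.inl i))
    | .Jb i => .inr (.inr (.inr (.inl i)))
    | .Jc i => .inr (.inr (.inr (.inr (.inl i))))
    | .Jα i => .inr (.inr (.inr (.inr (.inr (.inl i)))))
    | .Jβ i => .inr (.inr (.inr (.inr (.inr (.inr (.inl i))))))
    | .Jγ i => .inr (.inr (.inr (.inr (.inr (.inr (.inr (.inl i)))))))
    | .Jδ i => .inr (.inr (.inr (.inr (.inr (.inr (.inr (.inr (.inl i))))))))
    | .Jl1 => .inr (.inr (.inr (.inr (.inr (.inr (.inr (.inr (.inr (.inl ())))))))))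
    | .Jl2 => .inr (.inr (.inr (.inr (.inr (.inr (.inr (.inr (.inr (.inr (.inl ()))))))))))
    | .Jpart i => .inr (.inr (.inr (.inr (.inr (.inr (.inr (.inr (.inr (.inr (.inr i))))))))))
  invFun
    | .inl i => .JA i
    | .inr (.inl i) => .JB i
    | .inr (.inr (.inl i)) => .Ja i
    | .inr (.inr (.inr (.inl i))) => .Jb i
    | .inr (.inr (.inr (.inr (.inl i)))) => .Jc i
    | .inr (.inr (.inr (.inr (.inr (.inl i))))) => .Jα i
    | .inr (.inr (.inr (.inr (.inr (.inr (.inl i)))))) => .Jβ i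
    | .inr (.inr (.inr (.inr (.inr (.inr (.inr (.inl i))))))) => .Jγ i
    | .inr (.inr (.inr (.inr (.inr (.inr (.inr (.inr (.inl i)))))))) => .Jδ i
    | .inr (.inr (.inr (.inr (.inr (.inr (.inr (.inr (.inr (.inl _))))))))) => .Jl1
    | .inr (.inr (.inr (.inr (.inr (.inr (.inr (.inr (.inr (.inr (.inl _)))))))))) => .Jl2
    | .inr (.inr (.inr (.inr (.inr (.inr (.inr (.inr (.inr (.inr (.inr i)))))))))) => .Jpart i
  left_inv j := by cases j <;> rfl
  right_inv j := by
    rcases j with j | j | j | j | j | j | j | j | j | j | j | j <;> rfl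

lemma sum_job {z : ℕ} (f : Job z → ℤ) :
    ∑ j, f j = ∑ i, f (.JA i) + ∑ i, f (.JB i) + ∑ i, f (.Ja i) + ∑ i, f (.Jb i)
      + ∑ i, f (.Jc i) + ∑ i, f (.Jα i) + ∑ i, f (.Jβ i) + ∑ i, f (.Jγ i) + ∑ i, f (.Jδ i)
      + f .Jl1 + f .Jl2 + ∑ i, f (.Jpart i) := by
  rw [← (jobEquiv z).symm.sum_comp]
  simp only [Fintype.sum_sum_type, Finset.univ_unique, Finset.sum_singleton]
  simp only [jobEquiv, Equiv.coe_fn_symm_mk]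
  ring

lemma pγ {z D : ℕ} (ι : Fin (3*z) → ℕ) (hD : 0 < D) (i : Fin z) :
    (pJob z D ι (.Jγ i) : ℤ) = (D:ℤ)^5 + (3*z - (i.val+1))*(D:ℤ)^7 - D := by
  have h1 : i.val + 1 ≤ 3*z := by have := i.2; omega
  have h2 : D ≤ D^5 + (3*z - (i.val+1))*D^7 :=
    le_trans (Nat.le_self_pow (by norm_num) D) (Nat.le_add_right _ _)
  simp only [pJob]
  rw [Nat.cast_sub h2]
  push_cast [Nat.cast_sub h1]
  ring

lemma pδ {z D : ℕ} (ι : Fin (3*z) → ℕ) (i : Fin z) :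
    (pJob z D ι (.Jδ i) : ℤ) = (D:ℤ)^4 + (3*z - (i.val+1))*(D:ℤ)^7 := by
  have h1 : i.val + 1 ≤ 3*z := by have := i.2; omega
  simp only [pJob]
  push_cast [Nat.cast_sub h1]
  ring

lemma pβ {z D : ℕ} (ι : Fin (3*z) → ℕ) (i : Fin z) :
    (pJob z D ι (.Jβ i) : ℤ) = (D:ℤ)^2 + (D:ℤ)^4 + (4*z-1)*(D:ℤ)^7 + (D:ℤ)^8 := by
  have h1 : 1 ≤ 4*z := by have := i.2; omega
  simp only [pJob]
  push_cast [Nat.cast_sub h1]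
  ring

lemma pJob_pos {z D : ℕ} (ι : Fin (3*z) → ℕ) (hD : 1 < D) (hι : ∀ i, 0 < ι i) (j : Job z) :
    0 < pJob z D ι j := by
  have h0 : 0 < D := by omega
  cases j with
  | Jγ i =>
    have : D < D^5 + (3*z - (i.val+1))*D^7 :=
      lt_of_lt_of_le (lt_self_pow₀ hD (by norm_num)) (Nat.le_add_right _ _)
    simp only [pJob]; omega
  | Jpart i => exact hι i
  | _ => simp only [pJob]; positivity

/-- disjoint intervals inside `[a,b)` have total length at most `b - a`. -/
lemma sum_le_len {J : Type} [DecidableEq J] (p σ : J → ℕ) (S : Finset J) (a b : ℕ) 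
    (hS : ∀ j ∈ S, a ≤ σ j ∧ σ j + p j ≤ b)
    (hd : ∀ j ∈ S, ∀ j' ∈ S, j ≠ j' → σ j + p j ≤ σ j' ∨ σ j' + p j' ≤ σ j) :
    ∑ j ∈ S, p j ≤ b - a := by
  have h1 : (S.biUnion fun j => Finset.Ico (σ j) (σ j + p j)) ⊆ Finset.Ico a b := by
    intro t ht
    simp only [Finset.mem_biUnion, Finset.mem_Ico] at ht ⊢
    obtain ⟨j, hj, h⟩ := ht
    have := hS j hj
    omega
  have h2 := Finset.card_le_card h1
  rw [Finset.card_biUnion] at h2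
  · simpa using h2
  · intro j hj j' hj' hne
    rw [Function.onFun, Finset.disjoint_left]
    intro t ht ht'
    simp only [Finset.mem_Ico] at ht ht'
    have := hd j hj j' hj' hne
    omega

/-- no idle time: the start of `i` is the total length of jobs before it. -/
lemma start_eq {J : Type} [DecidableEq J] (p σ : J → ℕ) (S : Finset J) (W : ℕ)
    (hp : ∀ j, 0 < p j)
    (hW : ∀ j, σ j + p j ≤ W) (hload : ∑ j ∈ S, p j = W)
    (hd : ∀ j ∈ S, ∀ j' ∈ S, j ≠ j' → σ j + p j ≤ σ j' ∨ σ j' + p j' ≤ σ j)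
    (i : J) (hi : i ∈ S) :
    σ i = ∑ j ∈ S with σ j + p j ≤ σ i, p j := by
  have hsplit := Finset.sum_filter_add_sum_filter_not S (fun j => σ j + p j ≤ σ i) p
  have h1 : ∑ j ∈ S with σ j + p j ≤ σ i, p j ≤ σ i - 0 := by
    apply sum_le_len p σ _ 0 (σ i) 
    · intro j hj
      exact ⟨Nat.zero_le _, (Finset.mem_filter.1 hj).2⟩
    · intro j hj j' hj'
      exact hd j (Finset.mem_filter.1 hj).1 j' (Finset.mem_filter.1 hj').1
  have hiW := hW i
  have h2 : ∑ j ∈ S with ¬ (σ j + p j ≤ σ i), p j ≤ W - σ i := by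
    apply sum_le_len p σ _ (σ i) W
    · intro j hj
      obtain ⟨hjS, hj⟩ := Finset.mem_filter.1 hj
      refine ⟨?_, hW j⟩
      by_cases hji : j = i
      · rw [hji]
      · have := hd j hjS i hi hji
        have := hp i
        omega
    · intro j hj j' hj'
      exact hd j (Finset.mem_filter.1 hj).1 j' (Finset.mem_filter.1 hj').1
  omega

lemma eq_of_dvd_small (D a b k : ℤ) (h : a - b = D * k) (h1 : a - b < D) (h2 : b - a < D) :
    a = b := by
  have h3 : |a - b| < D := abs_lt.2 ⟨by linarith, h1⟩
  have h4 := Int.eq_zero_of_abs_lt_dvd ⟨k, h⟩ h3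
  linarith

lemma digits (D x y w x2 y2 w2 K : ℤ) (hD : 0 < D)
    (h : x + y*D + w*D^2 = x2 + y2*D + w2*D^2 + D^3*K)
    (hx : |x - x2| < D) (hy : |y - y2| < D) (hw : |w - w2| < D) : x = x2 ∧ y = y2 ∧ w = w2 := by
  rw [abs_lt] at hx hy hw
  have e1 : x = x2 := eq_of_dvd_small D x x2 (y2 - y + (w2 - w)*D + D^2*K) (by linear_combination h)
    (by linarith) (by linarith)
  subst e1
  have e2 : y = y2 := eq_of_dvd_small D y y2 ((w2 - w) + D*K)
    (mul_left_cancel₀ hD.ne' (by linear_combination h)) (by linarith) (by linarith)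
  subst e2
  refine ⟨rfl, rfl, ?_⟩
  exact eq_of_dvd_small D w w2 K
    (mul_left_cancel₀ (pow_ne_zero 2 hD.ne') (by linear_combination h)) (by linarith) (by linarith)

lemma numA (z D X x u x2 b2 g d P K L : ℤ) (hz : 0 < z) (hD : 4*z+8 < D)
    (h1 : X = x*(D^4+D^6+3*z*D^7) + u*D^3 + u*0 + L)
    (hL : u = 0 → L = 0) (hL2 : D^4 ∣ L)
    (h2 : X + g*D = x2*(D^4+D^6+3*z*D^7) + b2*(D^5+D^6+3*z*D^7) + g*D^5 + d*D^4 + P + D^7*K)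
    (hx : 0 ≤ x ∧ x ≤ z) (hu : 0 ≤ u ∧ u ≤ z + 1) (hx2 : 0 ≤ x2 ∧ x2 ≤ z) (hb2 : 0 ≤ b2 ∧ b2 ≤ z)
    (hg : 0 ≤ g ∧ g ≤ z) (hd : 0 ≤ d ∧ d ≤ z) (hP : 0 ≤ P ∧ P ≤ z*D) :
    u = 0 ∧ x = x2 := by
  obtain ⟨T, hT⟩ := hL2
  have hD0 : 0 < D := by linarith
  have hgD : g*D ≤ z*D := mul_le_mul_of_nonneg_right hg.2 hD0.le
  have hgD0 : 0 ≤ g*D := mul_nonneg hg.1 hD0.le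
  have hzD : z*D < D^2 := by nlinarith
  have hD23 : D^2 < D^3 := by nlinarith [sq_nonneg D, mul_pos hD0 hD0]
  have hD3 : 0 < D^3 := by positivity
  have hu3 : u*D^3 ≤ (z+1)*D^3 := mul_le_mul_of_nonneg_right hu.2 hD3.le
  have hu30 : 0 ≤ u*D^3 := mul_nonneg hu.1 hD3.le
  have hD4 : (z+2)*D^3 < D^4 := by nlinarith
  have e : u*D^3 + g*D = P := by
    apply eq_of_dvd_small (D^4) _ _
      (-T - x*(1+D^2+3*z*D^3) + x2*(1+D^2+3*z*D^3) + b2*(D+D^2+3*z*D^3) + g*D + d + D^3*K)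
    · subst hT; linear_combination h2 - h1
    · linarith
    · linarith
  have u0 : u = 0 := by
    by_contra hne
    have : 1 ≤ u := by have := hu.1; omega
    have : 1*D^3 ≤ u*D^3 := mul_le_mul_of_nonneg_right this hD3.le
    linarith
  have L0 := hL u0
  subst u0
  refine ⟨rfl, ?_⟩
  have key := digits D x 0 x (x2+d) (b2+g) (x2+b2) (3*z*x2+3*z*b2+K-3*z*x) hD0
    (mul_left_cancel₀ (pow_ne_zero 4 hD0.ne') (by linear_combination h2 - h1 - e - L0))
    (by rw [abs_lt]; constructor <;> linarith) (by rw [abs_lt]; constructor <;> linarith)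
    (by rw [abs_lt]; constructor <;> linarith)
  obtain ⟨k1, k2, k3⟩ := key
  linarith

lemma numB (z D X b u x2 b2 g d P K L : ℤ) (hz : 0 < z) (hD : 4*z+8 < D)
    (h1 : X = b*(D^5+D^6+3*z*D^7) + u*D^2 + L)
    (hL : u = 0 → L = 0) (hL2 : D^4 ∣ L)
    (h2 : X + g*D = x2*(D^4+D^6+3*z*D^7) + b2*(D^5+D^6+3*z*D^7) + g*D^5 + d*D^4 + P + D^7*K)
    (hb : 0 ≤ b ∧ b ≤ z) (hu : 0 ≤ u ∧ u ≤ z + 1) (hx2 : 0 ≤ x2 ∧ x2 ≤ z) (hb2 : 0 ≤ b2 ∧ b2 ≤ z)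
    (hg : 0 ≤ g ∧ g ≤ z) (hd : 0 ≤ d ∧ d ≤ z) (hP : 0 ≤ P ∧ P ≤ z*D) :
    u = 0 ∧ b = b2 := by
  obtain ⟨T, hT⟩ := hL2
  have hD0 : 0 < D := by linarith
  have hgD : g*D ≤ z*D := mul_le_mul_of_nonneg_right hg.2 hD0.le
  have hgD0 : 0 ≤ g*D := mul_nonneg hg.1 hD0.le
  have hzD : z*D < D^2 := by nlinarith
  have hD3 : 0 < D^2 := by positivity
  have hu3 : u*D^2 ≤ (z+1)*D^2 := mul_le_mul_of_nonneg_right hu.2 hD3.le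
  have hu30 : 0 ≤ u*D^2 := mul_nonneg hu.1 hD3.le
  have hD4' : (z+2)*D^2 < D^3 := by nlinarith
  have hD4 : D^3 ≤ D^4 := by nlinarith [pow_pos hD0 3]
  have hz2 : 0 < (z+1)*D^2 := by positivity
  have e : u*D^2 + g*D = P := by
    apply eq_of_dvd_small (D^4) _ _
      (-T - b*(D+D^2+3*z*D^3) + x2*(1+D^2+3*z*D^3) + b2*(D+D^2+3*z*D^3) + g*D + d + D^3*K)
    · subst hT; linear_combination h2 - h1
    · linarith
    · linarith
  have u0 : u = 0 := by
    by_contra hne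
    have : 1 ≤ u := by have := hu.1; omega
    have : 1*D^2 ≤ u*D^2 := mul_le_mul_of_nonneg_right this hD3.le
    linarith
  have L0 := hL u0
  subst u0
  refine ⟨rfl, ?_⟩
  have key := digits D 0 b b (x2+d) (b2+g) (x2+b2) (3*z*x2+3*z*b2+K-3*z*b) hD0
    (mul_left_cancel₀ (pow_ne_zero 4 hD0.ne') (by linear_combination h2 - h1 - e - L0))
    (by rw [abs_lt]; constructor <;> linarith) (by rw [abs_lt]; constructor <;> linarith)
    (by rw [abs_lt]; constructor <;> linarith)
  obtain ⟨k1, k2, k3⟩ := key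
  linarith

lemma sum_fin_z (z : ℕ) : 2 * ∑ i : Fin z, (i.val : ℤ) = z*(z-1) := by
  rw [Fin.sum_univ_eq_sum_range (fun i => (i:ℤ)) z]
  induction z with
  | zero => simp
  | succ n ih => rw [Finset.sum_range_succ, mul_add, ih]; push_cast; ring

/-- machine membership, as facts about each kind of job -/
lemma not_two_of_card_one {s : Finset ℕ} {a b : ℕ} (h : s.card = 1) (ha : a ∈ s) (hab : a ≠ b) :
    b ∉ s := by
  obtain ⟨c, rfl⟩ := Finset.card_eq_one.1 h
  simp only [Finset.mem_singleton] at *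
  omega

/-- indicator of machine `m` -/
def ind {z : ℕ} (ρ : Job z → Finset ℕ) (m : ℕ) (j : Job z) : ℤ := if m ∈ ρ j then 1 else 0

lemma mem_outer {z : ℕ} {ρ : Job z → Finset ℕ} (hc : ∀ j, (ρ j).card = qJob z j)
    (hnf : NormalForm ρ) (m : ℕ) (hm : m = 2 ∨ m = 3) :
    (∀ i, m ∉ ρ (.Jα i)) ∧ (∀ i, m ∉ ρ (.Jβ i)) ∧ m ∉ ρ .Jl1 ∧ m ∉ ρ .Jl2 := by
  obtain ⟨h1, h4, h23, ho⟩ := hnf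
  refine ⟨fun i => ?_, fun i => ?_, ?_, ?_⟩
  · exact not_two_of_card_one (hc _) ((h1 (.Jα i)).2 trivial) (by omega)
  · exact not_two_of_card_one (hc _) ((h4 (.Jβ i)).2 trivial) (by omega)
  · exact not_two_of_card_one (hc _) ((h1 .Jl1).2 trivial) (by omega)
  · exact not_two_of_card_one (hc _) ((h4 .Jl2).2 trivial) (by omega)

lemma load_eq {z : ℕ} (ρ : Job z → Finset ℕ) (p : Job z → ℕ) (m : ℕ) :
    ((∑ j with m ∈ ρ j, p j : ℕ) : ℤ) = ∑ j, ind ρ m j * p j := by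
  rw [Finset.sum_filter]; push_cast
  apply Finset.sum_congr rfl
  intro j _
  unfold ind; split_ifs <;> simp

lemma load1 {z D : ℕ} {ι : Fin (3*z) → ℕ} {ρ : Job z → Finset ℕ} (hnf : NormalForm ρ) :
    ∑ j with 1 ∈ ρ j, pJob z D ι j = Wval z D := by
  rw [← Nat.cast_inj (R := ℤ), load_eq, sum_job]
  simp [ind, hnf.1, M1Jobs, pJob, Wval]
  ring

lemma load4 {z D : ℕ} {ι : Fin (3*z) → ℕ} {ρ : Job z → Finset ℕ} (hnf : NormalForm ρ) :
    ∑ j with 4 ∈ ρ j, pJob z D ι j = Wval z D := by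
  rw [← Nat.cast_inj (R := ℤ), load_eq, sum_job]
  simp only [ind, hnf.2.1, M4Jobs, pβ]
  simp [pJob, Wval]
  ring

lemma load23 {z D : ℕ} {ι : Fin (3*z) → ℕ} {ρ : Job z → Finset ℕ} (hnf : NormalForm ρ)
    (hD : 0 < D) (hsum : ∑ i, ι i = z * D)
    (hc : ∀ j, (ρ j).card = qJob z j) :
    ∑ j with 2 ∈ ρ j, pJob z D ι j + ∑ j with 3 ∈ ρ j, pJob z D ι j = 2 * Wval z D := by
  rw [← Nat.cast_inj (R := ℤ), Nat.cast_add, load_eq, load_eq, ← Finset.sum_add_distrib, sum_job]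
  simp only [← add_mul]
  obtain ⟨a1, a2, a3, a4⟩ := mem_outer hc hnf 2 (by simp)
  obtain ⟨b1, b2, b3, b4⟩ := mem_outer hc hnf 3 (by simp)
  have two : ∀ j, BothM23 j → ind ρ 2 j + ind ρ 3 j = 2 := fun j hj => by
    have := hnf.2.2.1 j hj
    simp [ind, this]
  have one : ∀ j, OneM23 j → ind ρ 2 j + ind ρ 3 j = 1 := fun j hj => by
    have := hnf.2.2.2 j hj
    by_cases h3 : 3 ∈ ρ j <;> simp_all [ind]
  have zα : ∀ i, ind ρ 2 (.Jα i) + ind ρ 3 (.Jα i) = 0 := fun i => by simp [ind, a1, b1]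
  have zβ : ∀ i, ind ρ 2 (.Jβ i) + ind ρ 3 (.Jβ i) = 0 := fun i => by simp [ind, a2, b2]
  have z1 : ind ρ 2 .Jl1 + ind ρ 3 .Jl1 = 0 := by simp [ind, a3, b3]
  have z2 : ind ρ 2 .Jl2 + ind ρ 3 .Jl2 = 0 := by simp [ind, a4, b4]
  simp only [zα, zβ, z1, z2, fun i => two (.JA i) trivial, fun i => two (.JB i) trivial,
    fun i => two (.Jc i) trivial, fun i => one (.Ja i) trivial, fun i => one (.Jb i) trivial,
    fun i => one (.Jγ i) trivial, fun i => one (.Jδ i) trivial, fun i => one (.Jpart i) trivial,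
    pγ ι hD, pδ ι]
  have hs : ∑ i, (ι i : ℤ) = z * D := by exact_mod_cast hsum
  have t1 := sum_fin_z z
  have t2 := sum_fin_z (z+1)
  simp only [pJob, Wval]
  push_cast at t2 ⊢
  simp only [one_mul, zero_mul, hs, Finset.sum_const_zero, Finset.sum_const, Finset.card_univ,
    Fintype.card_fin, nsmul_eq_mul, Finset.sum_add_distrib, Finset.sum_sub_distrib,
    ← Finset.mul_sum, ← Finset.sum_mul]
  push_cast
  linear_combination (D:ℤ)^7 * t2 - (D:ℤ)^7 * t1

open Classical in
/-- 0/1 indicator used for counting -/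
noncomputable def bef {z : ℕ} (p σ : Job z → ℕ) (ρ : Job z → Finset ℕ) (i : Job z) (m : ℕ)
    (j : Job z) : ℤ := if m ∈ ρ j ∧ σ j + p j ≤ σ i then 1 else 0

lemma bef_sum {z n : ℕ} (p σ : Job z → ℕ) (ρ : Job z → Finset ℕ) (i : Job z) (m : ℕ)
    (f : Fin n → Job z) :
    0 ≤ ∑ k, bef p σ ρ i m (f k) ∧ ∑ k, bef p σ ρ i m (f k) ≤ n := by
  constructor
  · apply Finset.sum_nonneg
    intro k _; unfold bef; split_ifs <;> simp
  · calc ∑ k, bef p σ ρ i m (f k) ≤ ∑ k : Fin n, (1:ℤ) := by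
          apply Finset.sum_le_sum
          intro k _; unfold bef; split_ifs <;> simp
      _ = n := by simp

lemma start_bef {z : ℕ} (p σ : Job z → ℕ) (ρ : Job z → Finset ℕ) (W : ℕ)
    (hp : ∀ j, 0 < p j) (hW : ∀ j, σ j + p j ≤ W)
    (hd : ∀ j j', j ≠ j' → (ρ j ∩ ρ j').Nonempty → σ j + p j ≤ σ j' ∨ σ j' + p j' ≤ σ j)
    (m : ℕ) (hload : ∑ j with m ∈ ρ j, p j = W) (i : Job z) (hi : m ∈ ρ i) :
    (σ i : ℤ) = ∑ j, bef p σ ρ i m j * p j := by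
  have h := start_eq p σ (Finset.univ.filter fun j => m ∈ ρ j) W hp hW hload
    (fun j hj j' hj' hne => hd j j' hne ⟨m, by
      simp only [Finset.mem_filter, Finset.mem_univ, true_and] at hj hj'
      exact Finset.mem_inter.2 ⟨hj, hj'⟩⟩) i (by simpa using hi)
  rw [Finset.filter_filter, Finset.sum_filter] at h
  rw [← Nat.cast_inj (R := ℤ)] at h
  rw [h]
  push_cast
  apply Finset.sum_congr rfl
  intro j _
  unfold bef; split_ifs <;> simp

lemma load_le {z : ℕ} (p σ : Job z → ℕ) (ρ : Job z → Finset ℕ) (W : ℕ)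
    (hW : ∀ j, σ j + p j ≤ W)
    (hd : ∀ j j', j ≠ j' → (ρ j ∩ ρ j').Nonempty → σ j + p j ≤ σ j' ∨ σ j' + p j' ≤ σ j)
    (m : ℕ) : ∑ j with m ∈ ρ j, p j ≤ W := by
  have := sum_le_len p σ (Finset.univ.filter fun j => m ∈ ρ j) 0 W
    (fun j _ => ⟨Nat.zero_le _, hW j⟩) (fun j hj j' hj' hne => hd j j' hne ⟨m, by
      simp only [Finset.mem_filter, Finset.mem_univ, true_and] at hj hj'
      exact Finset.mem_inter.2 ⟨hj, hj'⟩⟩)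
  simpa using this

lemma wsum {z D : ℕ} (ι : Fin (3*z) → ℕ) (hD : 0 < D) (w : Job z → ℤ) :
    ∑ j, w j * (pJob z D ι j : ℤ) = (∑ k, w (.JA k)) * (D:ℤ)^2 + (∑ k, w (.JB k)) * (D:ℤ)^3
      + (∑ k, w (.Ja k)) * ((D:ℤ)^4+(D:ℤ)^6+3*z*(D:ℤ)^7)
      + (∑ k, w (.Jb k)) * ((D:ℤ)^5+(D:ℤ)^6+3*z*(D:ℤ)^7)
      + (∑ k, w (.Jc k) * (z + k.val + D)) * (D:ℤ)^7
      + (∑ k, w (.Jα k)) * ((D:ℤ)^3+(D:ℤ)^5+4*z*(D:ℤ)^7+(D:ℤ)^8)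
      + (∑ k, w (.Jβ k)) * ((D:ℤ)^2+(D:ℤ)^4+(4*z-1)*(D:ℤ)^7+(D:ℤ)^8)
      + ((∑ k, w (.Jγ k)) * ((D:ℤ)^5 - D) + (∑ k, w (.Jγ k) * (3*z-(k.val+1))) * (D:ℤ)^7)
      + ((∑ k, w (.Jδ k)) * (D:ℤ)^4 + (∑ k, w (.Jδ k) * (3*z-(k.val+1))) * (D:ℤ)^7)
      + w .Jl1 * ((D:ℤ)^3+z*(D:ℤ)^7+(D:ℤ)^8) + w .Jl2 * ((D:ℤ)^2+2*z*(D:ℤ)^7+(D:ℤ)^8)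
      + ∑ k, w (.Jpart k) * ι k := by
  rw [sum_job]
  simp only [Finset.sum_mul, ← Finset.sum_add_distrib, pγ ι hD, pδ ι, pβ ι]
  simp only [pJob]
  push_cast
  congr 12 <;> (funext k; ring)

lemma core (z D : ℕ) (ι : Fin (3*z) → ℕ)
    (hz : 0 < z) (hιpos : ∀ i, 0 < ι i) (hsum : ∑ i, ι i = z * D)
    (hD : 4*z*(7*z+1) < D)
    (σ : Job z → ℕ) (ρ : Job z → Finset ℕ)
    (hc : ∀ j, (ρ j).card = qJob z j)
    (hd : ∀ j j', j ≠ j' → (ρ j ∩ ρ j').Nonempty →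
      σ j + pJob z D ι j ≤ σ j' ∨ σ j' + pJob z D ι j' ≤ σ j)
    (hW : ∀ j, σ j + pJob z D ι j ≤ Wval z D)
    (hnf : NormalForm ρ) :
    ∃ i ∈ sA z ∪ sB z, σ i = 0 := by
  have hD8 : 4*z+8 < D := by nlinarith
  have hp := pJob_pos ι (show 1 < D by omega) hιpos
  have l1 := load1 (D := D) (ι := ι) hnf
  have l4 := load4 (D := D) (ι := ι) hnf
  have l23 := load23 hnf (show 0 < D by omega) hsum hc
  have l2le := load_le _ σ ρ _ hW hd 2
  have l3le := load_le _ σ ρ _ hW hd 3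
  have l2 : ∑ j with 2 ∈ ρ j, pJob z D ι j = Wval z D := by omega
  have l3 : ∑ j with 3 ∈ ρ j, pJob z D ι j = Wval z D := by omega
  obtain ⟨i, hi, hmin⟩ := Finset.exists_min_image (sA z ∪ sB z) σ
    ⟨.JA 0, by simp [sA]⟩
  refine ⟨i, hi, ?_⟩
  obtain ⟨w, hw⟩ : ∃ w, w = bef (pJob z D ι) σ ρ i := ⟨_, rfl⟩
  have hD0 : 0 < D := by omega
  have noA : ∀ m, ∑ k, w m (.JA k) = 0 := fun m => Finset.sum_eq_zero fun k _ => by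
    have h1 := hmin (.JA k) (by simp [sA])
    have h2 := hp (.JA k)
    rw [hw]; unfold bef; rw [if_neg]; rintro ⟨-, h⟩; omega
  have noB : ∀ m, ∑ k, w m (.JB k) = 0 := fun m => Finset.sum_eq_zero fun k _ => by
    have h1 := hmin (.JB k) (by simp [sB])
    have h2 := hp (.JB k)
    rw [hw]; unfold bef; rw [if_neg]; rintro ⟨-, h⟩; omega
  have wno : ∀ m j, m ∉ ρ j → w m j = 0 := fun m j h => by
    rw [hw]; unfold bef; rw [if_neg]; exact fun h' => h h'.1
  have weq : ∀ m m' j, m ∈ ρ j → m' ∈ ρ j → w m j = w m' j := fun m m' j h h' => by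
    rw [hw]; unfold bef; simp only [h, h']
  have b01 : ∀ m j, 0 ≤ w m j ∧ w m j ≤ 1 := fun m j => by
    rw [hw]; unfold bef; split_ifs <;> simp
  have bs : ∀ m (f : Fin z → Job z), 0 ≤ ∑ k, w m (f k) ∧ ∑ k, w m (f k) ≤ z := fun m f => by
    rw [hw]; exact bef_sum _ σ ρ i m f
  have hstart : ∀ m, ∑ j with m ∈ ρ j, pJob z D ι j = Wval z D → m ∈ ρ i →
      (σ i : ℤ) = ∑ j, w m j * (pJob z D ι j : ℤ) := fun m hl hmi => by
    rw [hw]; exact start_bef _ σ ρ _ hp hW hd m hl i hmi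
  have split : ∀ m (f : Fin z → Job z), (∀ k, m ∈ ρ (f k)) → (∀ k, OneM23 (f k)) →
      ∑ k, w m (f k) = ∑ k, w 2 (f k) + ∑ k, w 3 (f k) := fun m f h1 h2 => by
    rw [← Finset.sum_add_distrib]
    apply Finset.sum_congr rfl
    intro k _
    have h := hnf.2.2.2 (f k) (h2 k)
    by_cases h3 : 3 ∈ ρ (f k)
    · rw [wno 2 _ (fun h' => h.1 h' h3), zero_add]; exact weq _ _ _ (h1 k) h3
    · rw [wno 3 _ h3, add_zero]; exact weq _ _ _ (h1 k) (h.2 h3)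
  clear hw
  have i23 : 2 ∈ ρ i ∧ 3 ∈ ρ i := by
    apply hnf.2.2.1
    simp only [sA, sB, Finset.mem_union, Finset.mem_image, Finset.mem_univ, true_and] at hi
    rcases hi with ⟨k, rfl⟩ | ⟨k, rfl⟩ <;> trivial
  have hs : ∑ i, (ι i : ℤ) = z * D := by exact_mod_cast hsum
  -- inner machines
  have inner : ∀ m, (m = 2 ∨ m = 3) → ∃ g d P K : ℤ,
      (σ i : ℤ) + g*D = (∑ k, w m (.Ja k))*((D:ℤ)^4+(D:ℤ)^6+3*z*(D:ℤ)^7)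
        + (∑ k, w m (.Jb k))*((D:ℤ)^5+(D:ℤ)^6+3*z*(D:ℤ)^7) + g*(D:ℤ)^5 + d*(D:ℤ)^4 + P
        + (D:ℤ)^7*K ∧ (0 ≤ g ∧ g ≤ z) ∧ (0 ≤ d ∧ d ≤ z) ∧ (0 ≤ P ∧ P ≤ z*D) := by
    intro m hm
    have hst := hstart m (by rcases hm with rfl | rfl <;> assumption)
      (by rcases hm with rfl | rfl; exacts [i23.1, i23.2])
    obtain ⟨a1, a2, a3, a4⟩ := mem_outer hc hnf m hm
    have zα : ∑ k, w m (.Jα k) = 0 := Finset.sum_eq_zero fun k _ => wno _ _ (a1 k)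
    have zβ : ∑ k, w m (.Jβ k) = 0 := Finset.sum_eq_zero fun k _ => wno _ _ (a2 k)
    rw [wsum ι hD0, noA, noB, zα, zβ, wno _ _ a3, wno _ _ a4] at hst
    refine ⟨∑ k, w m (.Jγ k), ∑ k, w m (.Jδ k), ∑ k, w m (.Jpart k) * ι k,
      ∑ k, w m (.Jc k) * (z + k.val + D) + ∑ k, w m (.Jγ k) * (3*z-(k.val+1))
      + ∑ k, w m (.Jδ k) * (3*z-(k.val+1)), ?_, bs _ _, bs _ _, ?_, ?_⟩
    · linear_combination hst
    · exact Finset.sum_nonneg fun k _ => mul_nonneg (b01 _ _).1 (Int.natCast_nonneg _)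
    · rw [← hs]
      exact Finset.sum_le_sum fun k _ => mul_le_of_le_one_left (Int.natCast_nonneg _) (b01 _ _).2
  obtain ⟨g2, d2, P2, K2, e2, hg2, hd2, hP2⟩ := inner 2 (by simp)
  obtain ⟨g3, d3, P3, K3, e3, hg3, hd3, hP3⟩ := inner 3 (by simp)
  have hzZ : (0:ℤ) < z := by exact_mod_cast hz
  have hDZ : (4:ℤ)*z+8 < D := by exact_mod_cast hD8
  simp only [sA, sB, Finset.mem_union, Finset.mem_image, Finset.mem_univ, true_and] at hi
  rcases hi with ⟨k, hk⟩ | ⟨k, hk⟩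
  · have hst := hstart 1 l1 (by rw [hnf.1, ← hk]; trivial)
    have hno : ∀ j, ¬ M1Jobs j → w 1 j = 0 := fun j hj => wno _ _ (fun h => hj ((hnf.1 j).1 h))
    simp only [wsum ι hD0, noA, noB, fun k => hno (.Jb k) id, fun k => hno (.Jc k) id, fun k => hno (.Jβ k) id, fun k => hno (.Jγ k) id, fun k => hno (.Jδ k) id, fun k => hno (.Jpart k) id, hno .Jl2 id,
      zero_mul, Finset.sum_const_zero, add_zero, zero_add] at hst
    have hα := bs 1 Job.Jα
    have h1b := b01 1 .Jl1
    have hsplit := split 1 Job.Ja (fun k => (hnf.1 _).2 trivial) (fun k => trivial)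
    have key := fun x2 b2 g d P K => numA z D (σ i) (∑ k, w 1 (.Ja k))
      (∑ k, w 1 (.Jα k) + w 1 .Jl1) x2 b2 g d P K
      ((∑ k, w 1 (.Jα k)) * ((D:ℤ)^5+4*z*(D:ℤ)^7+(D:ℤ)^8)
        + w 1 .Jl1 * (z*(D:ℤ)^7+(D:ℤ)^8)) hzZ hDZ (by linear_combination hst)
      (fun h => by
        have e1 : ∑ k, w 1 (.Jα k) = 0 := by linarith
        have e2 : w 1 .Jl1 = 0 := by linarith
        rw [e1, e2]; ring)
      ⟨(∑ k, w 1 (.Jα k)) * ((D:ℤ)+4*z*(D:ℤ)^3+(D:ℤ)^4)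
        + w 1 .Jl1 * (z*(D:ℤ)^3+(D:ℤ)^4), by ring⟩
    have k2 := key _ _ _ _ _ _ e2 (bs _ _) ⟨by linarith, by linarith⟩ (bs _ _) (bs _ _) hg2 hd2 hP2
    have k3 := key _ _ _ _ _ _ e3 (bs _ _) ⟨by linarith, by linarith⟩ (bs _ _) (bs _ _) hg3 hd3 hP3
    have x0 : ∑ k, w 1 (.Ja k) = 0 := by linarith
    have e1 : ∑ k, w 1 (.Jα k) = 0 := by linarith
    have e2 : w 1 .Jl1 = 0 := by linarith
    rw [x0, e1, e2] at hst
    have : (σ i : ℤ) = 0 := by rw [hst]; ring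
    exact_mod_cast this
  · have hst := hstart 4 l4 (by rw [hnf.2.1, ← hk]; trivial)
    have hno : ∀ j, ¬ M4Jobs j → w 4 j = 0 := fun j hj => wno _ _ (fun h => hj ((hnf.2.1 j).1 h))
    simp only [wsum ι hD0, noA, noB, fun k => hno (.Ja k) id, fun k => hno (.Jc k) id, fun k => hno (.Jα k) id, fun k => hno (.Jγ k) id, fun k => hno (.Jδ k) id, fun k => hno (.Jpart k) id, hno .Jl1 id,
      zero_mul, Finset.sum_const_zero, add_zero, zero_add] at hst
    have hα := bs 4 Job.Jβ
    have h1b := b01 4 .Jl2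
    have hsplit := split 4 Job.Jb (fun k => (hnf.2.1 _).2 trivial) (fun k => trivial)
    have key := fun x2 b2 g d P K => numB z D (σ i) (∑ k, w 4 (.Jb k))
      (∑ k, w 4 (.Jβ k) + w 4 .Jl2) x2 b2 g d P K
      ((∑ k, w 4 (.Jβ k)) * ((D:ℤ)^4+(4*z-1)*(D:ℤ)^7+(D:ℤ)^8)
        + w 4 .Jl2 * (2*z*(D:ℤ)^7+(D:ℤ)^8)) hzZ hDZ (by linear_combination hst)
      (fun h => by
        have e1 : ∑ k, w 4 (.Jβ k) = 0 := by linarith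
        have e2 : w 4 .Jl2 = 0 := by linarith
        rw [e1, e2]; ring)
      ⟨(∑ k, w 4 (.Jβ k)) * (1+(4*z-1)*(D:ℤ)^3+(D:ℤ)^4)
        + w 4 .Jl2 * (2*z*(D:ℤ)^3+(D:ℤ)^4), by ring⟩
    have k2 := key _ _ _ _ _ _ e2 (bs _ _) ⟨by linarith, by linarith⟩ (bs _ _) (bs _ _) hg2 hd2 hP2
    have k3 := key _ _ _ _ _ _ e3 (bs _ _) ⟨by linarith, by linarith⟩ (bs _ _) (bs _ _) hg3 hd3 hP3
    have x0 : ∑ k, w 4 (.Jb k) = 0 := by linarith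
    have e1 : ∑ k, w 4 (.Jβ k) = 0 := by linarith
    have e2 : w 4 .Jl2 = 0 := by linarith
    rw [x0, e1, e2] at hst
    have : (σ i : ℤ) = 0 := by rw [hst]; ring
    exact_mod_cast this


/-- In every normal-form feasible schedule with makespan `W`, the jobs on machines 2 and 3
starting at time 0 and the jobs on machines 2 and 3 finishing at time `W` are in `A ∪ B`. -/
theorem first_and_last_job_in_A_union_B
    (z D : ℕ) (ι : Fin (3*z) → ℕ)
    (hz : 0 < z) (hDpos : 0 < D)
    (hιpos : ∀ i, 0 < ι i)
    (hsum : ∑ i, ι i = z * D)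
    (hlow : ∀ i, D < 4 * ι i)
    (hhigh : ∀ i, 2 * ι i < D)
    (hD : 4*z*(7*z+1) < D)
    (σ : Job z → ℕ) (ρ : Job z → Finset ℕ)
    (hfeas : Feasible 4 (pJob z D ι) (qJob z) σ ρ)
    (hmk : makespan (pJob z D ι) σ = Wval z D)
    (hnf : NormalForm ρ) :
    (∀ j, 2 ∈ ρ j → σ j = 0 → j ∈ sA z ∪ sB z) ∧
    (∀ j, 3 ∈ ρ j → σ j = 0 → j ∈ sA z ∪ sB z) ∧
    (∀ j, 2 ∈ ρ j → σ j + pJob z D ι j = Wval z D → j ∈ sA z ∪ sB z) ∧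
    (∀ j, 3 ∈ ρ j → σ j + pJob z D ι j = Wval z D → j ∈ sA z ∪ sB z) := by
  have hD8 : 4*z+8 < D := by nlinarith
  have hp := pJob_pos ι (show 1 < D by omega) hιpos
  obtain ⟨-, hc, hd⟩ := hfeas
  have hW : ∀ j, σ j + pJob z D ι j ≤ Wval z D := fun j => by
    rw [← hmk]
    exact Finset.le_sup (f := fun j => σ j + pJob z D ι j) (Finset.mem_univ j)
  have both : ∀ i ∈ sA z ∪ sB z, 2 ∈ ρ i ∧ 3 ∈ ρ i := fun i hi => by
    apply hnf.2.2.1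
    simp only [sA, sB, Finset.mem_union, Finset.mem_image, Finset.mem_univ, true_and] at hi
    rcases hi with ⟨k, rfl⟩ | ⟨k, rfl⟩ <;> trivial
  obtain ⟨i, hi, hi0⟩ := core z D ι hz hιpos hsum hD σ ρ hc hd hW hnf
  obtain ⟨e, he, he0⟩ := core z D ι hz hιpos hsum hD (fun j => Wval z D - (σ j + pJob z D ι j)) ρ hc
    (fun j j' hne hs => by
      have h1 := hd j j' hne hs
      have h2 := hW j
      have h3 := hW j'
      omega)
    (fun j => by have := hW j; omega) hnf
  have st : ∀ m j, m ∈ ρ i → m ∈ ρ j → σ j = 0 → j ∈ sA z ∪ sB z := fun m j hmi hmj h0 => by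
    by_contra hj
    have hne : j ≠ i := fun h => hj (h ▸ hi)
    have := hd j i hne ⟨m, Finset.mem_inter.2 ⟨hmj, hmi⟩⟩
    have := hp i
    have := hp j
    omega
  have en : ∀ m j, m ∈ ρ e → m ∈ ρ j → σ j + pJob z D ι j = Wval z D → j ∈ sA z ∪ sB z :=
    fun m j hmi hmj h0 => by
    by_contra hj
    have hne : j ≠ e := fun h => hj (h ▸ he)
    have := hd j e hne ⟨m, Finset.mem_inter.2 ⟨hmj, hmi⟩⟩
    have := hp e
    have := hp j
    have := hW e
    omega
  exact ⟨fun j => st 2 j (both i hi).1, fun j => st 3 j (both i hi).2,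
    fun j => en 2 j (both e he).1, fun j => en 3 j (both e he).2⟩
end

section
/- In every normal-form feasible schedule of the constructed instance with makespan W, for every job A' ∈ A the following counts at the start time of A' coincide: #_{A'} c − #_{A'} {λ_1} = #_{A'} B − #_{A'} {λ_1} = #_{A'} α = #_{A'} b = #_{A'} a. -/
namespace CAJ

theorem sum_job {z : ℕ} {M : Type*} [AddCommMonoid M] (f : Job z → M) :
    ∑ j, f j = (∑ i, f (.JA i)) + (∑ i, f (.JB i)) + (∑ i, f (.Ja i)) + (∑ i, f (.Jb i))
      + (∑ i, f (.Jc i)) + (∑ i, f (.Jα i)) + (∑ i, f (.Jβ i)) + (∑ i, f (.Jγ i))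
      + (∑ i, f (.Jδ i)) + f .Jl1 + f .Jl2 + ∑ i, f (.Jpart i) := by
  let e : (((((((((((Fin (z+1) ⊕ Fin (z+1)) ⊕ Fin z) ⊕ Fin z) ⊕ Fin (z+1)) ⊕ Fin z) ⊕ Fin z) ⊕ Fin z)
      ⊕ Fin z) ⊕ Unit) ⊕ Unit) ⊕ Fin (3*z)) → Job z :=
    Sum.elim (Sum.elim (Sum.elim (Sum.elim (Sum.elim (Sum.elim (Sum.elim (Sum.elim (Sum.elim (Sum.elim
      (Sum.elim .JA .JB) .Ja) .Jb) .Jc) .Jα) .Jβ) .Jγ) .Jδ) (fun _ => .Jl1)) (fun _ => .Jl2)) .Jpart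
  have he : Function.Bijective e := by
    constructor
    · intro x y h
      rcases x with (((((((((((x|x)|x)|x)|x)|x)|x)|x)|x)|x)|x)|x) <;>
      rcases y with (((((((((((y|y)|y)|y)|y)|y)|y)|y)|y)|y)|y)|y) <;> simp_all [e]
    · intro j
      cases j with
      | JA i => exact ⟨.inl (.inl (.inl (.inl (.inl (.inl (.inl (.inl (.inl (.inl (.inl i)))))))))), rfl⟩
      | JB i => exact ⟨.inl (.inl (.inl (.inl (.inl (.inl (.inl (.inl (.inl (.inl (.inr i)))))))))), rfl⟩
      | Ja i => exact ⟨.inl (.inl (.inl (.inl (.inl (.inl (.inl (.inl (.inl (.inr i))))))))), rfl⟩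
      | Jb i => exact ⟨.inl (.inl (.inl (.inl (.inl (.inl (.inl (.inl (.inr i)))))))), rfl⟩
      | Jc i => exact ⟨.inl (.inl (.inl (.inl (.inl (.inl (.inl (.inr i))))))), rfl⟩
      | Jα i => exact ⟨.inl (.inl (.inl (.inl (.inl (.inl (.inr i)))))), rfl⟩
      | Jβ i => exact ⟨.inl (.inl (.inl (.inl (.inl (.inr i))))), rfl⟩
      | Jγ i => exact ⟨.inl (.inl (.inl (.inl (.inr i)))), rfl⟩
      | Jδ i => exact ⟨.inl (.inl (.inl (.inr i))), rfl⟩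
      | Jl1 => exact ⟨.inl (.inl (.inr ())), rfl⟩
      | Jl2 => exact ⟨.inl (.inr ()), rfl⟩
      | Jpart i => exact ⟨.inr i, rfl⟩
  rw [← he.sum_comp f]
  simp [Fintype.sum_sum_type, e]

def kr {z : ℕ} (D : ℕ) (ι : Fin (3*z) → ℕ) : Job z → ℤ
  | .Jγ _ => -D
  | .Jpart i => ι i
  | _ => 0
def k2 {z : ℕ} : Job z → ℤ
  | .JA _ => 1
  | .Jβ _ => 1
  | .Jl2 => 1
  | _ => 0
def k3 {z : ℕ} : Job z → ℤ
  | .JB _ => 1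
  | .Jα _ => 1
  | .Jl1 => 1
  | _ => 0
def k4 {z : ℕ} : Job z → ℤ
  | .Ja _ => 1
  | .Jβ _ => 1
  | .Jδ _ => 1
  | _ => 0
def k5 {z : ℕ} : Job z → ℤ
  | .Jb _ => 1
  | .Jα _ => 1
  | .Jγ _ => 1
  | _ => 0
def k6 {z : ℕ} : Job z → ℤ
  | .Ja _ => 1
  | .Jb _ => 1
  | _ => 0
def k7 {z : ℕ} : Job z → ℤ
  | .Ja _ => 3*z
  | .Jb _ => 3*z
  | .Jc j => z + j.val
  | .Jα _ => 4*z
  | .Jβ _ => 4*z-1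
  | .Jγ j => 3*z-(j.val+1)
  | .Jδ j => 3*z-(j.val+1)
  | .Jl1 => z
  | .Jl2 => 2*z
  | _ => 0
def k8 {z : ℕ} : Job z → ℤ
  | .Jc _ => 1
  | .Jα _ => 1
  | .Jβ _ => 1
  | .Jl1 => 1
  | .Jl2 => 1
  | _ => 0

theorem p_decomp {z D : ℕ} (ι : Fin (3*z) → ℕ) (hz : 0 < z) (hD : 0 < D) (j : Job z) :
    (pJob z D ι j : ℤ) = kr D ι j + k2 j * D^2 + k3 j * D^3 + k4 j * D^4 + k5 j * D^5
      + k6 j * D^6 + k7 j * D^7 + k8 j * D^8 := by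
  cases j with
  | Jγ j =>
    have h1 : j.val + 1 ≤ 3*z := by omega
    have h2 : D ≤ D^5 + (3*z - (j.val+1))*D^7 :=
      le_trans (Nat.le_self_pow (by norm_num) D) (Nat.le_add_right _ _)
    simp only [pJob, kr, k2, k3, k4, k5, k6, k7, k8]
    rw [Nat.cast_sub h2]; push_cast [Nat.cast_sub h1]; ring
  | Jδ j =>
    have h1 : j.val + 1 ≤ 3*z := by omega
    simp only [pJob, kr, k2, k3, k4, k5, k6, k7, k8]
    push_cast [Nat.cast_sub h1]; ring
  | Jβ j =>
    have h1 : 1 ≤ 4*z := by omega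
    simp only [pJob, kr, k2, k3, k4, k5, k6, k7, k8]
    push_cast [Nat.cast_sub h1]; ring
  | _ => simp only [pJob, kr, k2, k3, k4, k5, k6, k7, k8]; push_cast; ring

theorem sum_p {z D : ℕ} (ι : Fin (3*z) → ℕ) (hz : 0 < z) (hD : 0 < D) (S : Finset (Job z)) :
    ((∑ j ∈ S, pJob z D ι j : ℕ) : ℤ) = (∑ j ∈ S, kr D ι j) + (∑ j ∈ S, k2 j) * D^2
      + (∑ j ∈ S, k3 j) * D^3 + (∑ j ∈ S, k4 j) * D^4 + (∑ j ∈ S, k5 j) * D^5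
      + (∑ j ∈ S, k6 j) * D^6 + (∑ j ∈ S, k7 j) * D^7 + (∑ j ∈ S, k8 j) * D^8 := by
  rw [Nat.cast_sum, Finset.sum_congr rfl (fun j _ => p_decomp ι hz hD j)]
  simp only [Finset.sum_add_distrib, Finset.sum_mul]

theorem sum_le_all {z : ℕ} (k : Job z → ℤ) (h0 : ∀ j, 0 ≤ k j) (S : Finset (Job z)) :
    0 ≤ ∑ j ∈ S, k j ∧ ∑ j ∈ S, k j ≤ ∑ j, k j :=
  ⟨Finset.sum_nonneg fun j _ => h0 j,
    Finset.sum_le_sum_of_subset_of_nonneg (Finset.subset_univ S) fun j _ _ => h0 j⟩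

theorem bnd {z D : ℕ} (hz : 0 < z) (hD : 4*z*(7*z+1) < D) (S : Finset (Job z)) :
    (0 ≤ ∑ j ∈ S, k2 j ∧ ∑ j ∈ S, k2 j < D) ∧ (0 ≤ ∑ j ∈ S, k3 j ∧ ∑ j ∈ S, k3 j < D) ∧
    (0 ≤ ∑ j ∈ S, k4 j ∧ ∑ j ∈ S, k4 j < D) ∧ (0 ≤ ∑ j ∈ S, k5 j ∧ ∑ j ∈ S, k5 j < D) ∧
    (0 ≤ ∑ j ∈ S, k6 j ∧ ∑ j ∈ S, k6 j < D) ∧ (0 ≤ ∑ j ∈ S, k7 j ∧ ∑ j ∈ S, k7 j < D) := by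
  have hD' : (4*z*(7*z+1) : ℤ) < D := by exact_mod_cast hD
  have hz' : (1 : ℤ) ≤ z := by exact_mod_cast hz
  have h2 := sum_le_all (z := z) k2 (by intro j; cases j <;> simp [k2]) S
  have h3 := sum_le_all (z := z) k3 (by intro j; cases j <;> simp [k3]) S
  have h4 := sum_le_all (z := z) k4 (by intro j; cases j <;> simp [k4]) S
  have h5 := sum_le_all (z := z) k5 (by intro j; cases j <;> simp [k5]) S
  have h6 := sum_le_all (z := z) k6 (by intro j; cases j <;> simp [k6]) S
  have h7 := sum_le_all (z := z) k7 (by intro j; cases j <;> simp only [k7] <;> omega) S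
  have e2 : ∑ j : Job z, k2 j = 2*z+2 := by rw [sum_job]; simp [k2]; ring
  have e3 : ∑ j : Job z, k3 j = 2*z+2 := by rw [sum_job]; simp [k3]; ring
  have e4 : ∑ j : Job z, k4 j = 3*z := by rw [sum_job]; simp [k4]; ring
  have e5 : ∑ j : Job z, k5 j = 3*z := by rw [sum_job]; simp [k5]; ring
  have e6 : ∑ j : Job z, k6 j = 2*z := by rw [sum_job]; simp [k6]; ring
  have c1 : ∑ i : Fin (z+1), k7 (Job.Jc i) ≤ (z+1)*(2*z) := by
    refine le_trans (Finset.sum_le_sum (g := fun _ => (2*z : ℤ)) fun i _ => ?_) (by simp)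
    simp only [k7]; omega
  have c2 : ∑ i : Fin z, k7 (Job.Jγ i) ≤ z*(3*z) := by
    refine le_trans (Finset.sum_le_sum (g := fun _ => (3*z : ℤ)) fun i _ => ?_) (by simp)
    simp only [k7]; omega
  have c3 : ∑ i : Fin z, k7 (Job.Jδ i) ≤ z*(3*z) := by
    refine le_trans (Finset.sum_le_sum (g := fun _ => (3*z : ℤ)) fun i _ => ?_) (by simp)
    simp only [k7]; omega
  have e7 : ∑ j : Job z, k7 j ≤ 22*z^2+5*z := by
    rw [sum_job]
    have : ∑ i : Fin z, k7 (Job.Ja i) = z*(3*z) := by simp [k7]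
    have : ∑ i : Fin z, k7 (Job.Jb i) = z*(3*z) := by simp [k7]
    have : ∑ i : Fin z, k7 (Job.Jα i) = z*(4*z) := by simp [k7]
    have : ∑ i : Fin z, k7 (Job.Jβ i) = z*(4*z-1) := by simp [k7]; ring
    have : ∑ i : Fin (z+1), k7 (Job.JA (z := z) i) = 0 := by simp [k7]
    have : ∑ i : Fin (z+1), k7 (Job.JB (z := z) i) = 0 := by simp [k7]
    have : ∑ i : Fin (3*z), k7 (Job.Jpart (z := z) i) = 0 := by simp [k7]
    have : k7 (Job.Jl1 (z := z)) = z := rfl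
    have : k7 (Job.Jl2 (z := z)) = 2*z := rfl
    nlinarith
  refine ⟨⟨h2.1, ?_⟩, ⟨h3.1, ?_⟩, ⟨h4.1, ?_⟩, ⟨h5.1, ?_⟩, ⟨h6.1, ?_⟩, ⟨h7.1, ?_⟩⟩ <;> nlinarith

theorem bndr {z D : ℕ} (ι : Fin (3*z) → ℕ) (hsum : ∑ i, ι i = z * D) (S : Finset (Job z)) :
    -(z*D : ℤ) ≤ ∑ j ∈ S, kr D ι j ∧ ∑ j ∈ S, kr D ι j ≤ z*D := by
  have hs : (∑ i, (ι i : ℤ)) = z * D := by exact_mod_cast hsum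
  let kp : Job z → ℤ := fun j => match j with | .Jpart i => ι i | _ => 0
  let kn : Job z → ℤ := fun j => match j with | .Jγ _ => D | _ => 0
  have hk : ∀ j, kr D ι j = kp j - kn j := by intro j; cases j <;> simp [kr, kp, kn]
  have h1 := sum_le_all kp (by intro j; cases j <;> simp [kp]) S
  have h2 := sum_le_all kn (by intro j; cases j <;> simp [kn]) S
  have e1 : ∑ j, kp j = z*D := by rw [sum_job]; simp [kp, hs]
  have e2 : ∑ j, kn j = z*D := by rw [sum_job]; simp [kn]
  simp only [hk, Finset.sum_sub_distrib]
  constructor <;> linarith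

theorem peel {D e r : ℤ} (h1 : -D < e) (h2 : e < D) (h : e + D * r = 0) : e = 0 ∧ r = 0 := by
  have hD : 0 < D := by linarith
  have : r = 0 := by
    by_contra hr
    rcases lt_or_gt_of_ne hr with h' | h' <;> nlinarith
  subst this; constructor <;> linarith

/-- equal loads have equal digits -/
theorem digits {z D : ℕ} (ι : Fin (3*z) → ℕ) (hz : 0 < z) (hsum : ∑ i, ι i = z * D)
    (hD : 4*z*(7*z+1) < D) (S T : Finset (Job z))
    (h : ∑ j ∈ S, pJob z D ι j = ∑ j ∈ T, pJob z D ι j) :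
    (∑ j ∈ S, k3 j = ∑ j ∈ T, k3 j) ∧ (∑ j ∈ S, k4 j = ∑ j ∈ T, k4 j) ∧
    (∑ j ∈ S, k5 j = ∑ j ∈ T, k5 j) ∧ (∑ j ∈ S, k6 j = ∑ j ∈ T, k6 j) ∧
    (∑ j ∈ S, k8 j = ∑ j ∈ T, k8 j) := by
  have hD0 : 0 < D := by omega
  have h' : ((∑ j ∈ S, pJob z D ι j : ℕ) : ℤ) = ((∑ j ∈ T, pJob z D ι j : ℕ) : ℤ) := by rw [h]
  rw [sum_p ι hz hD0, sum_p ι hz hD0] at h'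
  have hD' : (4*z*(7*z+1) : ℤ) < D := by exact_mod_cast hD
  have hz' : (1 : ℤ) ≤ z := by exact_mod_cast hz
  obtain ⟨s2, s3, s4, s5, s6, s7⟩ := bnd hz hD S
  obtain ⟨t2, t3, t4, t5, t6, t7⟩ := bnd hz hD T
  have sr := bndr ι hsum S
  have tr := bndr ι hsum T
  have hzD : (2*z : ℤ) < D := by nlinarith
  generalize (D : ℤ) = d at *
  generalize ∑ j ∈ S, k2 j = a2 at *
  generalize ∑ j ∈ S, k3 j = a3 at *
  generalize ∑ j ∈ S, k4 j = a4 at *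
  generalize ∑ j ∈ S, k5 j = a5 at *
  generalize ∑ j ∈ S, k6 j = a6 at *
  generalize ∑ j ∈ S, k7 j = a7 at *
  generalize ∑ j ∈ S, k8 j = a8 at *
  generalize ∑ j ∈ T, k2 j = b2 at *
  generalize ∑ j ∈ T, k3 j = b3 at *
  generalize ∑ j ∈ T, k4 j = b4 at *
  generalize ∑ j ∈ T, k5 j = b5 at *
  generalize ∑ j ∈ T, k6 j = b6 at *
  generalize ∑ j ∈ T, k7 j = b7 at *
  generalize ∑ j ∈ T, k8 j = b8 at *
  generalize ∑ j ∈ S, kr D ι j = ar at *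
  generalize ∑ j ∈ T, kr D ι j = br at *
  have q1 := peel (D := d^2) (e := ar - br)
    (r := (a2-b2) + d*((a3-b3) + d*((a4-b4)+d*((a5-b5)+d*((a6-b6)+d*((a7-b7)+d*(a8-b8)))))))
    (by nlinarith) (by nlinarith) (by linear_combination h')
  have q2 := peel (by linarith) (by linarith) q1.2
  have q3 := peel (by linarith) (by linarith) q2.2
  have q4 := peel (by linarith) (by linarith) q3.2
  have q5 := peel (by linarith) (by linarith) q4.2
  have q6 := peel (by linarith) (by linarith) q5.2
  have q7 := peel (by linarith) (by linarith) q6.2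
  refine ⟨?_, ?_, ?_, ?_, ?_⟩ <;> linarith [q3.1, q4.1, q5.1, q6.1, q7.2]

/-- a load without big jobs is short -/
theorem short {z D : ℕ} (ι : Fin (3*z) → ℕ) (hz : 0 < z) (hsum : ∑ i, ι i = z * D)
    (hD : 4*z*(7*z+1) < D) (S : Finset (Job z)) (h8 : ∀ j ∈ S, k8 j = 0) :
    ∑ j ∈ S, pJob z D ι j < D^8 := by
  have hD0 : 0 < D := by omega
  have h' := sum_p ι hz hD0 S
  rw [Finset.sum_eq_zero h8] at h'
  have hD' : (4*z*(7*z+1) : ℤ) < D := by exact_mod_cast hD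
  have hz' : (1 : ℤ) ≤ z := by exact_mod_cast hz
  obtain ⟨s2, s3, s4, s5, s6, s7⟩ := bnd hz hD S
  have sr := bndr ι hsum S
  have hzD : (2*z : ℤ) < D := by nlinarith
  zify at *
  rw [h']
  generalize (D : ℤ) = d at *
  have m2 := mul_le_mul_of_nonneg_right (Int.le_sub_one_of_lt s2.2) (by positivity : 0 ≤ d^2)
  have m3 := mul_le_mul_of_nonneg_right (Int.le_sub_one_of_lt s3.2) (by positivity : 0 ≤ d^3)
  have m4 := mul_le_mul_of_nonneg_right (Int.le_sub_one_of_lt s4.2) (by positivity : 0 ≤ d^4)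
  have m5 := mul_le_mul_of_nonneg_right (Int.le_sub_one_of_lt s5.2) (by positivity : 0 ≤ d^5)
  have m6 := mul_le_mul_of_nonneg_right (Int.le_sub_one_of_lt s6.2) (by positivity : 0 ≤ d^6)
  have m7 := mul_le_mul_of_nonneg_right (Int.le_sub_one_of_lt s7.2) (by positivity : 0 ≤ d^7)
  have : (z*d : ℤ) < d^2 := by nlinarith
  ring_nf at m2 m3 m4 m5 m6 m7 this sr ⊢
  linarith

section packing
variable {J : Type} [DecidableEq J] (S : Finset J) (p σ : J → ℕ)

theorem card_bi (hd : ∀ i ∈ S, ∀ j ∈ S, i ≠ j → σ i + p i ≤ σ j ∨ σ j + p j ≤ σ i) :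
    (S.biUnion fun i => Finset.Ico (σ i) (σ i + p i)).card = ∑ i ∈ S, p i := by
  rw [Finset.card_biUnion]
  · simp
  · intro i hi j hj hij
    rw [Function.onFun, Finset.disjoint_left]
    intro x hx hy
    simp only [Finset.mem_Ico] at hx hy
    rcases hd i hi j hj hij with h | h <;> omega

theorem pack (hd : ∀ i ∈ S, ∀ j ∈ S, i ≠ j → σ i + p i ≤ σ j ∨ σ j + p j ≤ σ i) (L R : ℕ)
    (h : ∀ i ∈ S, L ≤ σ i ∧ σ i + p i ≤ R) : ∑ i ∈ S, p i ≤ R - L := by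
  rw [← card_bi S p σ hd, ← Nat.card_Ico]
  apply Finset.card_le_card
  intro x hx
  simp only [Finset.mem_biUnion, Finset.mem_Ico] at hx ⊢
  obtain ⟨i, hi, h1, h2⟩ := hx
  have := h i hi
  omega

theorem cover (hd : ∀ i ∈ S, ∀ j ∈ S, i ≠ j → σ i + p i ≤ σ j ∨ σ j + p j ≤ σ i) (W : ℕ)
    (h : ∀ i ∈ S, σ i + p i ≤ W) (hW : ∑ i ∈ S, p i = W) (t : ℕ) (ht : t < W) :
    ∃ i ∈ S, σ i ≤ t ∧ t < σ i + p i := by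
  have : (S.biUnion fun i => Finset.Ico (σ i) (σ i + p i)) = Finset.Ico 0 W := by
    apply Finset.eq_of_subset_of_card_le
    · intro x hx
      simp only [Finset.mem_biUnion, Finset.mem_Ico] at hx ⊢
      obtain ⟨i, hi, h1, h2⟩ := hx
      have := h i hi
      omega
    · rw [card_bi S p σ hd, hW]; simp
  have ht' : t ∈ Finset.Ico 0 W := by simp [ht]
  rw [← this] at ht'
  simpa using ht'

theorem load (hd : ∀ i ∈ S, ∀ j ∈ S, i ≠ j → σ i + p i ≤ σ j ∨ σ j + p j ≤ σ i) (W : ℕ)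
    (h : ∀ i ∈ S, σ i + p i ≤ W) (hW : ∑ i ∈ S, p i = W) (t : ℕ) (ht : t ≤ W)
    (hs : ∀ i ∈ S, σ i + p i ≤ t ∨ t ≤ σ i) :
    ∑ i ∈ S with σ i + p i ≤ t, p i = t := by
  have e := Finset.sum_filter_add_sum_filter_not S (fun i => σ i + p i ≤ t) p
  have h1 := pack (S.filter (fun i => σ i + p i ≤ t)) p σ
    (fun i hi j hj => hd i (Finset.mem_filter.1 hi).1 j (Finset.mem_filter.1 hj).1) 0 t
    (fun i hi => ⟨Nat.zero_le _, (Finset.mem_filter.1 hi).2⟩)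
  have h2 := pack (S.filter (fun i => ¬ σ i + p i ≤ t)) p σ
    (fun i hi j hj => hd i (Finset.mem_filter.1 hi).1 j (Finset.mem_filter.1 hj).1) t W
    (fun i hi => ⟨(hs i (Finset.mem_filter.1 hi).1).resolve_left (Finset.mem_filter.1 hi).2,
      h i (Finset.mem_filter.1 hi).1⟩)
  omega
end packing

end CAJ

namespace CAJ

structure Ctx {z : ℕ} (p σ : Job z → ℕ) (ρ : Job z → Finset ℕ) (W : ℕ) : Prop where
  disj : ∀ μ i j, μ ∈ ρ i → μ ∈ ρ j → i ≠ j → σ i + p i ≤ σ j ∨ σ j + p j ≤ σ i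
  endW : ∀ j, σ j + p j ≤ W
  full1 : ∑ j with 1 ∈ ρ j, p j = W
  full2 : ∑ j with 2 ∈ ρ j, p j = W
  full3 : ∑ j with 3 ∈ ρ j, p j = W
  pos : ∀ j, 0 < p j
  m1 : ∀ j, 1 ∈ ρ j ↔ M1Jobs j
  both : ∀ j, BothM23 j → 2 ∈ ρ j ∧ 3 ∈ ρ j
  one : ∀ j, OneM23 j → ((2 ∈ ρ j) ↔ ¬ (3 ∈ ρ j))
  none : ∀ j, ¬ BothM23 j → ¬ OneM23 j → 2 ∉ ρ j ∧ 3 ∉ ρ j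

theorem p_pos {z D : ℕ} (ι : Fin (3*z) → ℕ) (hz : 0 < z) (hD : 2 ≤ D) (hι : ∀ i, 0 < ι i)
    (j : Job z) : 0 < pJob z D ι j := by
  have : 0 < D := by omega
  cases j with
  | Jγ j =>
    simp only [pJob]
    have : D < D^5 := by
      calc D = D^1 := (pow_one D).symm
        _ < D^5 := Nat.pow_lt_pow_right (by omega) (by norm_num)
    omega
  | Jpart i => exact hι i
  | _ => simp only [pJob]; positivity

theorem fin_sum (z : ℕ) : (∑ i : Fin (z+1), (i.val : ℤ)) = (∑ i : Fin z, (i.val : ℤ)) + z := by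
  rw [Fin.sum_univ_castSucc]; simp

def g {z : ℕ} : Job z → ℤ
  | .JA _ => 2
  | .JB _ => 2
  | .Jc _ => 2
  | .Jα _ => 0
  | .Jβ _ => 0
  | .Jl1 => 0
  | .Jl2 => 0
  | _ => 1

theorem g_both {z : ℕ} (j : Job z) (h : BothM23 j) : g j = 2 := by
  cases j <;> first | rfl | exact absurd h id
theorem g_one {z : ℕ} (j : Job z) (h : OneM23 j) : g j = 1 := by
  cases j <;> first | rfl | exact absurd h id
theorem g_none {z : ℕ} (j : Job z) (h : ¬ BothM23 j) (h2 : ¬ OneM23 j) : g j = 0 := by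
  cases j <;> first | rfl | exact absurd trivial h | exact absurd trivial h2

set_option maxHeartbeats 1000000 in
theorem mkCtx {z D : ℕ} (ι : Fin (3*z) → ℕ)
    (hz : 0 < z) (hιpos : ∀ i, 0 < ι i)
    (hsum : ∑ i, ι i = z * D) (hD : 4*z*(7*z+1) < D)
    (σ : Job z → ℕ) (ρ : Job z → Finset ℕ)
    (hfeas : Feasible 4 (pJob z D ι) (qJob z) σ ρ)
    (hmk : makespan (pJob z D ι) σ = Wval z D)
    (hnf : NormalForm ρ) : Ctx (pJob z D ι) σ ρ (Wval z D) := by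
  have hD2 : 2 ≤ D := by nlinarith
  obtain ⟨f1, f2, f3⟩ := hfeas
  obtain ⟨n1, n4, nb, no⟩ := hnf
  have disj : ∀ μ i j, μ ∈ ρ i → μ ∈ ρ j → i ≠ j →
      σ i + pJob z D ι i ≤ σ j ∨ σ j + pJob z D ι j ≤ σ i := fun μ i j hi hj hij =>
    f3 i j hij ⟨μ, Finset.mem_inter.2 ⟨hi, hj⟩⟩
  have endW : ∀ j, σ j + pJob z D ι j ≤ Wval z D := by
    intro j
    rw [← hmk]
    exact Finset.le_sup (f := fun j => σ j + pJob z D ι j) (Finset.mem_univ j)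
  have none : ∀ j, ¬ BothM23 j → ¬ OneM23 j → 2 ∉ ρ j ∧ 3 ∉ ρ j := by
    intro j h1 h2
    have key : ∀ x, x ∈ ρ j → (ρ j).card = 1 → ∀ y, y ≠ x → y ∉ ρ j := by
      intro x hx hc y hy hyj
      exact hy (Finset.card_le_one.1 hc.le y hyj x hx)
    cases j with
    | Jα i => exact ⟨key 1 ((n1 _).2 trivial) (f2 _) 2 (by norm_num), key 1 ((n1 _).2 trivial) (f2 _) 3 (by norm_num)⟩
    | Jl1 => exact ⟨key 1 ((n1 _).2 trivial) (f2 _) 2 (by norm_num), key 1 ((n1 _).2 trivial) (f2 _) 3 (by norm_num)⟩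
    | Jβ i => exact ⟨key 4 ((n4 _).2 trivial) (f2 _) 2 (by norm_num), key 4 ((n4 _).2 trivial) (f2 _) 3 (by norm_num)⟩
    | Jl2 => exact ⟨key 4 ((n4 _).2 trivial) (f2 _) 2 (by norm_num), key 4 ((n4 _).2 trivial) (f2 _) 3 (by norm_num)⟩
    | _ => simp [BothM23, OneM23] at h1 h2
  have full1 : ∑ j with 1 ∈ ρ j, pJob z D ι j = Wval z D := by
    rw [Finset.sum_filter, sum_job]
    simp [n1, M1Jobs, pJob, Wval]
    ring
  have hle : ∀ μ, ∑ j with μ ∈ ρ j, pJob z D ι j ≤ Wval z D := by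
    intro μ
    refine pack _ (pJob z D ι) σ (fun i hi j hj => disj μ i j (by simpa using hi) (by simpa using hj)) 0 _ ?_
    intro i _
    exact ⟨Nat.zero_le _, endW i⟩
  have tot : ((∑ j with 2 ∈ ρ j, pJob z D ι j : ℕ) : ℤ) + (∑ j with 3 ∈ ρ j, pJob z D ι j : ℕ)
      = 2 * Wval z D := by
    have hg : ∀ j, (if 2 ∈ ρ j then (pJob z D ι j : ℤ) else 0) + (if 3 ∈ ρ j then (pJob z D ι j : ℤ) else 0)
        = g j * pJob z D ι j := by
      intro j
      by_cases hb : BothM23 j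
      · have := g_both j hb
        rw [if_pos (nb j hb).1, if_pos (nb j hb).2, this]; ring
      · by_cases ho : OneM23 j
        · have := g_one j ho
          have h := no j ho
          rw [this]
          by_cases h3 : 3 ∈ ρ j <;> simp [h3, h]
        · have := g_none j hb ho
          rw [if_neg (none j hb ho).1, if_neg (none j hb ho).2, this]; ring
    rw [Nat.cast_sum, Nat.cast_sum, Finset.sum_filter, Finset.sum_filter, ← Finset.sum_add_distrib,
      Finset.sum_congr rfl (fun j _ => hg j), Finset.sum_congr rfl
        (fun j _ => by rw [p_decomp ι hz (by omega : 0 < D) j]), sum_job]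
    have hs : (∑ i, (ι i : ℤ)) = z * D := by exact_mod_cast hsum
    simp only [g, kr, k2, k3, k4, k5, k6, k7, k8, Wval]
    simp [Finset.sum_add_distrib, ← Finset.mul_sum, ← Finset.sum_mul, fin_sum, hs]
    ring
  have t2 := hle 2
  have t3 := hle 3
  exact ⟨disj, endW, full1, by omega, by omega, p_pos ι hz hD2 hιpos, n1, nb, no, none⟩
end CAJ

namespace CAJ

/-- number of members of the family in the set -/
def fc {z n : ℕ} (S : Finset (Job z)) (X : Fin n → Job z) : ℤ := ∑ i, if X i ∈ S then 1 else 0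

theorem k3_sum {z : ℕ} (S : Finset (Job z)) :
    ∑ j ∈ S, k3 j = fc S .JB + fc S .Jα + (if .Jl1 ∈ S then 1 else 0) := by
  rw [← Finset.univ_inter S, ← Finset.sum_ite_mem, sum_job]; simp [k3, fc]
theorem k5_sum {z : ℕ} (S : Finset (Job z)) :
    ∑ j ∈ S, k5 j = fc S .Jb + fc S .Jα + fc S .Jγ := by
  rw [← Finset.univ_inter S, ← Finset.sum_ite_mem, sum_job]; simp [k5, fc]
theorem k6_sum {z : ℕ} (S : Finset (Job z)) :
    ∑ j ∈ S, k6 j = fc S .Ja + fc S .Jb := by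
  rw [← Finset.univ_inter S, ← Finset.sum_ite_mem, sum_job]; simp [k6, fc]
theorem k8_sum {z : ℕ} (S : Finset (Job z)) :
    ∑ j ∈ S, k8 j = fc S .Jc + fc S .Jα + fc S .Jβ + (if .Jl1 ∈ S then 1 else 0)
      + (if .Jl2 ∈ S then 1 else 0) := by
  rw [← Finset.univ_inter S, ← Finset.sum_ite_mem, sum_job]; simp [k8, fc]

section ctx
variable {z : ℕ} (p σ : Job z → ℕ) (ρ : Job z → Finset ℕ) (W : ℕ)

/-- jobs on machine `μ` finished at time `t` -/
def SS (μ t : ℕ) : Finset (Job z) := {j ∈ {j | μ ∈ ρ j} | σ j + p j ≤ t}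
/-- all jobs finished at time `t` -/
def FF (t : ℕ) : Finset (Job z) := {j | σ j + p j ≤ t}

theorem mem_SS {μ t : ℕ} {j : Job z} : j ∈ SS p σ ρ μ t ↔ μ ∈ ρ j ∧ σ j + p j ≤ t := by
  simp [SS]
theorem mem_FF {t : ℕ} {j : Job z} : j ∈ FF p σ t ↔ σ j + p j ≤ t := by
  simp [FF]

def Sync (τ : ℕ) : Prop := τ ≤ W ∧ ∀ j, (2 ∈ ρ j ∨ 3 ∈ ρ j) → σ j + p j ≤ τ ∨ τ ≤ σ j

variable {p σ ρ W}

theorem fc_congr {n : ℕ} {S T : Finset (Job z)} {X : Fin n → Job z}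
    (h : ∀ i, X i ∈ S ↔ X i ∈ T) : fc S X = fc T X := by
  simp [fc, h]
theorem fc_mono {n : ℕ} {S T : Finset (Job z)} {X : Fin n → Job z}
    (h : ∀ i, X i ∈ S → X i ∈ T) : fc S X ≤ fc T X := by
  refine Finset.sum_le_sum fun i _ => ?_
  have := h i
  split_ifs <;> simp_all
theorem fc_zero {n : ℕ} {S : Finset (Job z)} {X : Fin n → Job z}
    (h : ∀ i, X i ∉ S) : fc S X = 0 := by
  simp [fc, h]
theorem fc_split {n : ℕ} {X : Fin n → Job z} (h : ∀ i, 2 ∈ ρ (X i) ↔ ¬ 3 ∈ ρ (X i)) (t : ℕ) :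
    fc (SS p σ ρ 2 t) X + fc (SS p σ ρ 3 t) X = fc (FF p σ t) X := by
  simp only [fc, ← Finset.sum_add_distrib, mem_SS, mem_FF]
  refine Finset.sum_congr rfl fun i _ => ?_
  have := h i
  by_cases h3 : 3 ∈ ρ (X i) <;> simp [this, h3]

theorem Ctx.load2 (C : Ctx p σ ρ W) {t : ℕ} (h : Sync p σ ρ W t) : ∑ j ∈ SS p σ ρ 2 t, p j = t :=
  load _ p σ (fun i hi j hj => C.disj 2 i j (by simpa using hi) (by simpa using hj)) W
    (fun i _ => C.endW i) C.full2 t h.1 (fun i hi => h.2 i (Or.inl (by simpa using hi)))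
theorem Ctx.load3 (C : Ctx p σ ρ W) {t : ℕ} (h : Sync p σ ρ W t) : ∑ j ∈ SS p σ ρ 3 t, p j = t :=
  load _ p σ (fun i hi j hj => C.disj 3 i j (by simpa using hi) (by simpa using hj)) W
    (fun i _ => C.endW i) C.full3 t h.1 (fun i hi => h.2 i (Or.inr (by simpa using hi)))

theorem Ctx.sync_start (C : Ctx p σ ρ W) {x : Job z} (hx : BothM23 x) : Sync p σ ρ W (σ x) := by
  refine ⟨le_trans (Nat.le_add_right _ _) (C.endW x), fun j hj => ?_⟩
  by_cases e : j = x
  · right; rw [e]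
  · have : σ j + p j ≤ σ x ∨ σ x + p x ≤ σ j := by
      rcases hj with hj | hj
      · exact C.disj 2 j x hj (C.both x hx).1 e
      · exact C.disj 3 j x hj (C.both x hx).2 e
    omega
theorem Ctx.sync_end (C : Ctx p σ ρ W) {x : Job z} (hx : BothM23 x) :
    Sync p σ ρ W (σ x + p x) := by
  refine ⟨C.endW x, fun j hj => ?_⟩
  by_cases e : j = x
  · left; rw [e]
  · have : σ j + p j ≤ σ x ∨ σ x + p x ≤ σ j := by
      rcases hj with hj | hj
      · exact C.disj 2 j x hj (C.both x hx).1 e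
      · exact C.disj 3 j x hj (C.both x hx).2 e
    omega

theorem Ctx.a23 (C : Ctx p σ ρ W) (i : Fin z) : 2 ∈ ρ (.Ja i) ∨ 3 ∈ ρ (.Ja i) := by
  have := C.one (.Ja i) trivial
  tauto
end ctx

section main
variable {z D : ℕ} {ι : Fin (3*z) → ℕ} {σ : Job z → ℕ} {ρ : Job z → Finset ℕ} {W : ℕ}

theorem seg_short (C : Ctx (pJob z D ι) σ ρ W) (hz : 0 < z) (hsum : ∑ i, ι i = z * D)
    (hD : 4*z*(7*z+1) < D) {t1 t2 : ℕ} (h12 : t1 < t2) (s1 : Sync (pJob z D ι) σ ρ W t1)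
    (s2 : Sync (pJob z D ι) σ ρ W t2)
    (hno : ∀ t, t1 < t → t < t2 → ¬ Sync (pJob z D ι) σ ρ W t)
    (i : Fin z) (hi1 : t1 ≤ σ (.Ja i)) (hi2 : σ (.Ja i) + pJob z D ι (.Ja i) ≤ t2) :
    t2 < t1 + D^8 := by
  have l1 := C.load2 s1
  have l2 := C.load2 s2
  rw [← Finset.sum_filter_add_sum_filter_not _ (fun j => σ j + pJob z D ι j ≤ t1)] at l2
  have e : Finset.filter (fun j => σ j + pJob z D ι j ≤ t1) (SS (pJob z D ι) σ ρ 2 t2)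
      = SS (pJob z D ι) σ ρ 2 t1 := by
    ext j; simp only [Finset.mem_filter, mem_SS]
    constructor
    · rintro ⟨⟨a, b⟩, c⟩; exact ⟨a, c⟩
    · rintro ⟨a, b⟩; exact ⟨⟨a, by omega⟩, b⟩
  rw [e, l1] at l2
  have := short ι hz hsum hD
    (Finset.filter (fun j => ¬ σ j + pJob z D ι j ≤ t1) (SS (pJob z D ι) σ ρ 2 t2)) ?_
  · omega
  · intro j hj
    simp only [Finset.mem_filter, mem_SS] at hj
    obtain ⟨⟨m2, he⟩, hne⟩ := hj
    cases j with
    | Jα i => exact absurd m2 (C.none _ id id).1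
    | Jβ i => exact absurd m2 (C.none _ id id).1
    | Jl1 => exact absurd m2 (C.none _ id id).1
    | Jl2 => exact absurd m2 (C.none _ id id).1
    | Jc k =>
      exfalso
      have b1 := C.sync_start (x := .Jc k) trivial
      have b2 := C.sync_end (x := .Jc k) trivial
      have g1 := (s1.2 _ (Or.inl m2)).resolve_left hne
      have pp := C.pos (.Jc k)
      have pi := C.pos (.Ja i)
      have n1 : ¬ t1 < σ (.Jc k) := fun h => hno _ h (by omega) b1
      have n2 : ¬ σ (.Jc k) + pJob z D ι (.Jc k) < t2 := fun h => hno _ (by omega) h b2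
      have : σ (.Jc k) + pJob z D ι (.Jc k) ≤ σ (.Ja i) ∨ σ (.Ja i) + pJob z D ι (.Ja i) ≤ σ (.Jc k) := by
        rcases C.a23 i with h | h
        · exact C.disj 2 _ _ m2 h (by simp)
        · exact C.disj 3 _ _ (C.both (.Jc k) trivial).2 h (by simp)
      omega
    | _ => rfl

theorem nopair (C : Ctx (pJob z D ι) σ ρ W) (hz : 0 < z) (hsum : ∑ i, ι i = z * D)
    (hD : 4*z*(7*z+1) < D) {t1 t2 : ℕ} (h12 : t1 < t2) (s1 : Sync (pJob z D ι) σ ρ W t1)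
    (s2 : Sync (pJob z D ι) σ ρ W t2)
    (hno : ∀ t, t1 < t → t < t2 → ¬ Sync (pJob z D ι) σ ρ W t) :
    ∀ n μ ν i j, (μ = 2 ∧ ν = 3 ∨ μ = 3 ∧ ν = 2) → μ ∈ ρ (.Ja i) → ν ∈ ρ (.Ja j) →
      t1 ≤ σ (.Ja i) → σ (.Ja j) + pJob z D ι (.Ja j) ≤ t2 →
      σ (.Ja i) + pJob z D ι (.Ja i) ≤ σ (.Ja j) → σ (.Ja j) - σ (.Ja i) ≤ n → False := by
  intro n
  induction n with
  | zero =>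
    intro μ ν i j _ _ _ _ _ h5 h6
    have := C.pos (.Ja i)
    omega
  | succ n ih =>
    intro μ ν i j hμν hi hj hi1 hj2 hij hn
    have pi := C.pos (.Ja i)
    have pj := C.pos (.Ja j)
    rcases hij.eq_or_lt with heq | hlt
    · refine hno (σ (.Ja j)) (by omega) (by omega) ⟨?_, fun h hh => ?_⟩
      · have := s2.1; omega
      · have : μ ∈ ρ h ∨ ν ∈ ρ h := by
          rcases hμν with ⟨rfl, rfl⟩ | ⟨rfl, rfl⟩
          · exact hh
          · exact hh.symm
        rcases this with hm | hm
        · by_cases e : h = .Ja i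
          · subst e; omega
          · have := C.disj μ _ _ hm hi e
            omega
        · by_cases e : h = .Ja j
          · subst e; omega
          · have := C.disj ν _ _ hm hj e
            omega
    · obtain ⟨h, hh, hs, he⟩ := cover {j | 1 ∈ ρ j} (pJob z D ι) σ
        (fun i hi j hj => C.disj 1 i j (by simpa using hi) (by simpa using hj)) W
        (fun i _ => C.endW i) C.full1 (σ (.Ja i) + pJob z D ι (.Ja i))
        (by have := s2.1; omega)
      have h1 : 1 ∈ ρ h := by simpa using hh
      have ei : h ≠ .Ja i := by rintro rfl; omega
      have ej : h ≠ .Ja j := by rintro rfl; omega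
      have di := C.disj 1 _ _ h1 ((C.m1 (.Ja i)).2 trivial) ei
      have dj := C.disj 1 _ _ h1 ((C.m1 (.Ja j)).2 trivial) ej
      have sh := seg_short C hz hsum hD h12 s1 s2 hno i hi1 (by omega)
      have pc := C.pos h
      cases h with
      | JA k => exact hno _ (by omega) (by omega) (C.sync_start (x := .JA k) trivial)
      | Ja k =>
        have : μ ∈ ρ (.Ja k) ∨ ν ∈ ρ (.Ja k) := by
          rcases hμν with ⟨rfl, rfl⟩ | ⟨rfl, rfl⟩
          · exact C.a23 k
          · exact (C.a23 k).symm
        rcases this with hk | hk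
        · exact ih μ ν k j hμν hk hj (by omega) hj2 (by omega) (by omega)
        · exact ih μ ν i k hμν hi hk hi1 (by omega) (by omega) (by omega)
      | Jα k =>
        have : D^8 ≤ pJob z D ι (.Jα k) := by simp only [pJob]; omega
        omega
      | Jl1 =>
        have : D^8 ≤ pJob z D ι .Jl1 := by simp only [pJob]; omega
        omega
      | _ => exact absurd ((C.m1 _).1 h1) id

/-- balance at a sync time -/
theorem balance (C : Ctx (pJob z D ι) σ ρ W) (hz : 0 < z) (hsum : ∑ i, ι i = z * D)
    (hD : 4*z*(7*z+1) < D) {t : ℕ} (s : Sync (pJob z D ι) σ ρ W t) :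
    fc (SS (pJob z D ι) σ ρ 2 t) .Jγ - fc (SS (pJob z D ι) σ ρ 3 t) .Jγ
      = fc (SS (pJob z D ι) σ ρ 2 t) .Ja - fc (SS (pJob z D ι) σ ρ 3 t) .Ja := by
  obtain ⟨-, -, h5, h6, -⟩ := digits ι hz hsum hD _ _ ((C.load2 s).trans (C.load3 s).symm)
  rw [k5_sum, k5_sum] at h5
  rw [k6_sum, k6_sum] at h6
  have z2 : fc (SS (pJob z D ι) σ ρ 2 t) .Jα = 0 :=
    fc_zero fun i h => (C.none (.Jα i) id id).1 ((mem_SS _ _ _).1 h).1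
  have z3 : fc (SS (pJob z D ι) σ ρ 3 t) .Jα = 0 :=
    fc_zero fun i h => (C.none (.Jα i) id id).2 ((mem_SS _ _ _).1 h).1
  linarith

theorem mono_step (C : Ctx (pJob z D ι) σ ρ W) (hz : 0 < z) (hsum : ∑ i, ι i = z * D)
    (hD : 4*z*(7*z+1) < D) {t1 t2 : ℕ} (h12 : t1 < t2) (s1 : Sync (pJob z D ι) σ ρ W t1)
    (s2 : Sync (pJob z D ι) σ ρ W t2)
    (hno : ∀ t, t1 < t → t < t2 → ¬ Sync (pJob z D ι) σ ρ W t) :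
    fc (FF (pJob z D ι) σ t1) .Jγ - fc (FF (pJob z D ι) σ t1) .Ja
      ≤ fc (FF (pJob z D ι) σ t2) .Jγ - fc (FF (pJob z D ι) σ t2) .Ja := by
  have b1 := balance C hz hsum hD s1
  have b2 := balance C hz hsum hD s2
  have ga1 := fc_split (p := pJob z D ι) (σ := σ) (fun i => C.one (.Ja i) trivial) t1
  have ga2 := fc_split (p := pJob z D ι) (σ := σ) (fun i => C.one (.Ja i) trivial) t2
  have gg1 := fc_split (p := pJob z D ι) (σ := σ) (fun i => C.one (.Jγ i) trivial) t1
  have gg2 := fc_split (p := pJob z D ι) (σ := σ) (fun i => C.one (.Jγ i) trivial) t2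
  have mono : ∀ μ, ∀ X : Fin z → Job z, fc (SS (pJob z D ι) σ ρ μ t1) X ≤ fc (SS (pJob z D ι) σ ρ μ t2) X := by
    intro μ X
    refine fc_mono fun i hi => ?_
    rw [mem_SS] at hi ⊢
    exact ⟨hi.1, by omega⟩
  have m2 := mono 2 .Jγ
  have m3 := mono 3 .Jγ
  have key : fc (SS (pJob z D ι) σ ρ 2 t1) .Ja = fc (SS (pJob z D ι) σ ρ 2 t2) .Ja ∨
      fc (SS (pJob z D ι) σ ρ 3 t1) .Ja = fc (SS (pJob z D ι) σ ρ 3 t2) .Ja := by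
    by_contra hcon
    rw [not_or] at hcon
    have ex : ∀ μ, (μ = 2 ∨ μ = 3) →
        fc (SS (pJob z D ι) σ ρ μ t1) .Ja ≠ fc (SS (pJob z D ι) σ ρ μ t2) .Ja →
        ∃ i, μ ∈ ρ (.Ja i) ∧ t1 ≤ σ (.Ja i) ∧ σ (.Ja i) + pJob z D ι (.Ja i) ≤ t2 := by
      intro μ hμ hne
      by_contra hall
      push Not at hall
      refine hne (fc_congr fun i => ?_)
      rw [mem_SS, mem_SS]
      constructor
      · rintro ⟨a, b⟩; exact ⟨a, by omega⟩
      · rintro ⟨a, b⟩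
        refine ⟨a, ?_⟩
        have hh : 2 ∈ ρ (.Ja i) ∨ 3 ∈ ρ (.Ja i) := by
          rcases hμ with rfl | rfl
          · exact Or.inl a
          · exact Or.inr a
        rcases s1.2 _ hh with h | h
        · exact h
        · have := hall i a h; omega
    obtain ⟨i, i1, i2, i3⟩ := ex 2 (Or.inl rfl) hcon.1
    obtain ⟨j, j1, j2, j3⟩ := ex 3 (Or.inr rfl) hcon.2
    have hij : Job.Ja i ≠ Job.Ja j := by
      intro e
      rw [e] at i1
      exact (C.one (.Ja j) trivial).1 i1 j1
    rcases C.disj 1 _ _ ((C.m1 (.Ja i)).2 trivial) ((C.m1 (.Ja j)).2 trivial) hij with h | h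
    · exact nopair C hz hsum hD h12 s1 s2 hno _ 2 3 i j (Or.inl ⟨rfl, rfl⟩) i1 j1 i2 j3 h le_rfl
    · exact nopair C hz hsum hD h12 s1 s2 hno _ 3 2 j i (Or.inr ⟨rfl, rfl⟩) j1 i1 j2 i3 h le_rfl
  rcases key with k | k <;> linarith

theorem mono_all (C : Ctx (pJob z D ι) σ ρ W) (hz : 0 < z) (hsum : ∑ i, ι i = z * D)
    (hD : 4*z*(7*z+1) < D) : ∀ n t1 t2, t2 - t1 ≤ n → t1 ≤ t2 → Sync (pJob z D ι) σ ρ W t1 →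
    Sync (pJob z D ι) σ ρ W t2 →
    fc (FF (pJob z D ι) σ t1) .Jγ - fc (FF (pJob z D ι) σ t1) .Ja
      ≤ fc (FF (pJob z D ι) σ t2) .Jγ - fc (FF (pJob z D ι) σ t2) .Ja := by
  intro n
  induction n with
  | zero =>
    intro t1 t2 h1 h2 _ _
    have : t1 = t2 := by omega
    rw [this]
  | succ n ih =>
    intro t1 t2 h1 h2 s1 s2
    rcases h2.eq_or_lt with h | h
    · rw [h]
    · by_cases hex : ∃ t, t1 < t ∧ t < t2 ∧ Sync (pJob z D ι) σ ρ W t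
      · obtain ⟨t, a, b, s⟩ := hex
        exact (ih t1 t (by omega) a.le s1 s).trans (ih t t2 (by omega) b.le s s2)
      · push Not at hex
        exact mono_step C hz hsum hD h s1 s2 hex

theorem gamma_eq (C : Ctx (pJob z D ι) σ ρ W) (hz : 0 < z) (hsum : ∑ i, ι i = z * D)
    (hD : 4*z*(7*z+1) < D) {t : ℕ} (s : Sync (pJob z D ι) σ ρ W t) :
    fc (FF (pJob z D ι) σ t) .Jγ = fc (FF (pJob z D ι) σ t) .Ja := by
  have s0 : Sync (pJob z D ι) σ ρ W 0 := ⟨Nat.zero_le _, fun j _ => Or.inr (Nat.zero_le _)⟩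
  have sW : Sync (pJob z D ι) σ ρ W W := ⟨le_rfl, fun j _ => Or.inl (C.endW j)⟩
  have h1 := mono_all C hz hsum hD _ 0 t le_rfl (Nat.zero_le _) s0 s
  have h2 := mono_all C hz hsum hD _ t W le_rfl s.1 s sW
  have e0 : ∀ X : Fin z → Job z, fc (FF (pJob z D ι) σ 0) X = 0 := fun X =>
    fc_zero fun i h => by
      rw [mem_FF] at h
      have := C.pos (X i)
      omega
  have eW : ∀ X : Fin z → Job z, fc (FF (pJob z D ι) σ W) X = z := fun X => by
    have : ∀ i, X i ∈ FF (pJob z D ι) σ W := fun i => (mem_FF _ _).2 (C.endW _)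
    simp [fc, this]
  rw [e0, e0] at h1
  rw [eW, eW] at h2
  linarith

theorem cnt_fc {n : ℕ} (p : Job z → ℕ) (X : Fin n → Job z) (hX : Function.Injective X) (x : Job z) :
    (cnt p σ (Finset.univ.image X) x : ℤ) = fc (FF p σ (σ x)) X := by
  unfold cnt fc
  rw [Finset.filter_image, Finset.card_image_of_injective _ hX]
  simp [mem_FF]

theorem final (C : Ctx (pJob z D ι) σ ρ W) (hz : 0 < z) (hsum : ∑ i, ι i = z * D)
    (hD : 4*z*(7*z+1) < D) (k : Fin (z+1)) (F : Finset (Job z))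
    (hF : F = FF (pJob z D ι) σ (σ (.JA k))) :
    fc F .Jc = fc F .Jα + (if Job.Jl1 ∈ F then 1 else 0) ∧
    fc F .JB = fc F .Jα + (if Job.Jl1 ∈ F then 1 else 0) ∧
    fc F .Jα = fc F .Jb ∧ fc F .Jb = fc F .Ja := by
  subst hF
  have s := C.sync_start (x := .JA k) trivial
  have hg := gamma_eq C hz hsum hD s
  have l1 : ∑ j ∈ SS (pJob z D ι) σ ρ 1 (σ (.JA k)), pJob z D ι j = σ (.JA k) := by
    refine load _ _ σ (fun i hi j hj => C.disj 1 i j (by simpa using hi) (by simpa using hj)) W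
      (fun i _ => C.endW i) C.full1 _ s.1 (fun i hi => ?_)
    have hi : 1 ∈ ρ i := by simpa using hi
    by_cases e : i = .JA k
    · right; rw [e]
    · have := C.disj 1 _ _ hi ((C.m1 (.JA k)).2 trivial) e
      omega
  generalize σ (.JA k) = t at *
  have ga := fc_split (p := pJob z D ι) (σ := σ) (fun i => C.one (.Ja i) trivial) t
  have gb := fc_split (p := pJob z D ι) (σ := σ) (fun i => C.one (.Jb i) trivial) t
  have gg := fc_split (p := pJob z D ι) (σ := σ) (fun i => C.one (.Jγ i) trivial) t
  obtain ⟨p3, -, p5, p6, p8⟩ := digits ι hz hsum hD _ _ (l1.trans (C.load2 s).symm)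
  obtain ⟨-, -, q5, q6, -⟩ := digits ι hz hsum hD _ _ (l1.trans (C.load3 s).symm)
  have on1 : ∀ {n : ℕ} (X : Fin n → Job z), (∀ i, M1Jobs (X i)) →
      fc (SS (pJob z D ι) σ ρ 1 t) X = fc (FF (pJob z D ι) σ t) X := fun X hX =>
    fc_congr fun i => by rw [mem_SS, mem_FF]; simp [(C.m1 _).2 (hX i)]
  have off1 : ∀ {n : ℕ} (X : Fin n → Job z), (∀ i, ¬ M1Jobs (X i)) →
      fc (SS (pJob z D ι) σ ρ 1 t) X = 0 := fun X hX =>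
    fc_zero fun i h => hX i ((C.m1 _).1 ((mem_SS _ _ _).1 h).1)
  have on2 : ∀ {n : ℕ} (X : Fin n → Job z), (∀ i, BothM23 (X i)) →
      fc (SS (pJob z D ι) σ ρ 2 t) X = fc (FF (pJob z D ι) σ t) X := fun X hX =>
    fc_congr fun i => by rw [mem_SS, mem_FF]; simp [(C.both _ (hX i)).1]
  have off2 : ∀ {n : ℕ} (X : Fin n → Job z), (∀ i, ¬ BothM23 (X i)) → (∀ i, ¬ OneM23 (X i)) →
      fc (SS (pJob z D ι) σ ρ 2 t) X = 0 := fun X hX hY =>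
    fc_zero fun i h => (C.none _ (hX i) (hY i)).1 ((mem_SS _ _ _).1 h).1
  have off3 : ∀ {n : ℕ} (X : Fin n → Job z), (∀ i, ¬ BothM23 (X i)) → (∀ i, ¬ OneM23 (X i)) →
      fc (SS (pJob z D ι) σ ρ 3 t) X = 0 := fun X hX hY =>
    fc_zero fun i h => (C.none _ (hX i) (hY i)).2 ((mem_SS _ _ _).1 h).1
  rw [k3_sum, k3_sum, off1 .JB (fun _ => id), on1 .Jα (fun _ => trivial), on2 .JB (fun _ => trivial),
    off2 .Jα (fun _ => id) (fun _ => id)] at p3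
  rw [k8_sum, k8_sum, off1 .Jc (fun _ => id), on1 .Jα (fun _ => trivial), off1 .Jβ (fun _ => id),
    on2 .Jc (fun _ => trivial), off2 .Jα (fun _ => id) (fun _ => id),
    off2 .Jβ (fun _ => id) (fun _ => id)] at p8
  rw [k5_sum, k5_sum, off1 .Jb (fun _ => id), on1 .Jα (fun _ => trivial), off1 .Jγ (fun _ => id),
    off2 .Jα (fun _ => id) (fun _ => id)] at p5
  rw [k5_sum, k5_sum, off1 .Jb (fun _ => id), on1 .Jα (fun _ => trivial), off1 .Jγ (fun _ => id),
    off3 .Jα (fun _ => id) (fun _ => id)] at q5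
  rw [k6_sum, k6_sum, on1 .Ja (fun _ => trivial), off1 .Jb (fun _ => id)] at p6
  rw [k6_sum, k6_sum, on1 .Ja (fun _ => trivial), off1 .Jb (fun _ => id)] at q6
  have a1 : (Job.Jl1 ∈ SS (pJob z D ι) σ ρ 1 t) = (Job.Jl1 ∈ FF (pJob z D ι) σ t) := by
    rw [mem_SS, mem_FF]; simp [(C.m1 .Jl1).2 trivial]
  have a2 : (Job.Jl1 ∈ SS (pJob z D ι) σ ρ 2 t) = False := by
    rw [mem_SS]; simp [(C.none .Jl1 id id).1]
  have a3 : (Job.Jl2 ∈ SS (pJob z D ι) σ ρ 2 t) = False := by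
    rw [mem_SS]; simp [(C.none .Jl2 id id).1]
  have a4 : (Job.Jl2 ∈ SS (pJob z D ι) σ ρ 1 t) = False := by
    rw [mem_SS]
    have : ¬ 1 ∈ ρ .Jl2 := fun h => absurd ((C.m1 _).1 h) id
    simp [this]
  simp only [a1, a2, a3, a4, if_false] at p3 p8
  refine ⟨?_, ?_, ?_, ?_⟩ <;> linarith
end main

end CAJ

/-- Equation (1): at the start of every job `A' ∈ A` we have
`#c − #λ₁ = #B − #λ₁ = #α = #b = #a`. -/
theorem counts_at_A_jobs
    (z D : ℕ) (ι : Fin (3*z) → ℕ)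
    (hz : 0 < z) (hDpos : 0 < D)
    (hιpos : ∀ i, 0 < ι i)
    (hsum : ∑ i, ι i = z * D)
    (hlow : ∀ i, D < 4 * ι i)
    (hhigh : ∀ i, 2 * ι i < D)
    (hD : 4*z*(7*z+1) < D)
    (σ : Job z → ℕ) (ρ : Job z → Finset ℕ)
    (hfeas : Feasible 4 (pJob z D ι) (qJob z) σ ρ)
    (hmk : makespan (pJob z D ι) σ = Wval z D)
    (hnf : NormalForm ρ) :
    ∀ A' ∈ sA z,
      (cnt (pJob z D ι) σ (sc z) A' : ℤ) - cnt (pJob z D ι) σ {Job.Jl1} A' =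
        (cnt (pJob z D ι) σ (sB z) A' : ℤ) - cnt (pJob z D ι) σ {Job.Jl1} A' ∧
      (cnt (pJob z D ι) σ (sB z) A' : ℤ) - cnt (pJob z D ι) σ {Job.Jl1} A' =
        (cnt (pJob z D ι) σ (sα z) A' : ℤ) ∧
      cnt (pJob z D ι) σ (sα z) A' = cnt (pJob z D ι) σ (sb z) A' ∧
      cnt (pJob z D ι) σ (sb z) A' = cnt (pJob z D ι) σ (sa z) A' := by
  intro A' hA
  obtain ⟨k, -, rfl⟩ := Finset.mem_image.1 hA
  have C := CAJ.mkCtx ι hz hιpos hsum hD σ ρ hfeas hmk hnf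
  obtain ⟨h1, h2, h3, h4⟩ := CAJ.final C hz hsum hD k _ rfl
  have ec := CAJ.cnt_fc (σ := σ) (pJob z D ι) Job.Jc (fun a b h => by injection h) (.JA k)
  have eB := CAJ.cnt_fc (σ := σ) (pJob z D ι) Job.JB (fun a b h => by injection h) (.JA k)
  have ea := CAJ.cnt_fc (σ := σ) (pJob z D ι) Job.Ja (fun a b h => by injection h) (.JA k)
  have eb := CAJ.cnt_fc (σ := σ) (pJob z D ι) Job.Jb (fun a b h => by injection h) (.JA k)
  have eα := CAJ.cnt_fc (σ := σ) (pJob z D ι) Job.Jα (fun a b h => by injection h) (.JA k)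
  have el : (cnt (pJob z D ι) σ {Job.Jl1} (.JA k) : ℤ) =
      if Job.Jl1 ∈ CAJ.FF (pJob z D ι) σ (σ (.JA k)) then 1 else 0 := by
    simp only [cnt, Finset.filter_singleton, CAJ.mem_FF]
    split_ifs <;> simp
  simp only [sc, sB, sα, sa, sb]
  rw [ec, eB, el, eα]
  refine ⟨by linarith, by linarith, ?_, ?_⟩
  · exact_mod_cast (eα.trans (h3.trans eb.symm))
  · exact_mod_cast (eb.trans (h4.trans ea.symm))
end
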